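/- arXiv:0812.4354 — 15 statements merged into one kernel-verified Lean document; each statement's English description precedes it below -/
import Mathlib

section
/- Let a : ℕ≥1 → ℂ satisfy a(1) = 1 and fix(a) = a, i.e. Σ_{d∣n} d·a(d) = a(n) for all n ≥ 1. Then a is multiplicative: a(mn) = a(m)·a(n) for all m, n ≥ 1 with gcd(m,n) = 1. -/
open Complex Finset

theorem stmt2 (a : ℕ → ℂ) (ha1 : a 1 = 1)
    (hfix : ∀ n : ℕ, 1 ≤ n → ∑ d ∈ n.divisors, (d : ℂ) * a d = a n) :
    ∀ m n : ℕ, 1 ≤ m → 1 ≤ n → Nat.Coprime m n → a (m * n) = a m * a n := by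
  suffices H : ∀ N m n : ℕ, m * n = N → 1 ≤ m → 1 ≤ n → Nat.Coprime m n →
      a (m * n) = a m * a n from fun m n => H _ m n rfl
  intro N
  induction N using Nat.strong_induction_on with
  | _ N ih =>
  intro m n hN hm hn hc
  by_cases h1 : m * n = 1
  · have hm1 : m = 1 := Nat.eq_one_of_mul_eq_one_right h1
    have hn1 : n = 1 := Nat.eq_one_of_mul_eq_one_left h1
    subst hm1 hn1
    simp [ha1]
  have e1 : a (m * n) = ∑ p ∈ m.divisors ×ˢ n.divisors,
      ((p.1 : ℂ) * p.2) * a (p.1 * p.2) := by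
    rw [← hfix (m * n) (Nat.mul_pos hm hn), Nat.divisors_mul, Finset.mul_def,
      Finset.sum_image hc.mul_injOn_divisors]
    exact Finset.sum_congr rfl fun p _ => by push_cast; rfl
  have e2 : a m * a n = ∑ p ∈ m.divisors ×ˢ n.divisors,
      ((p.1 : ℂ) * p.2) * (a p.1 * a p.2) := by
    conv_lhs => rw [← hfix m hm, ← hfix n hn, Finset.sum_mul_sum, ← Finset.sum_product']
    exact Finset.sum_congr rfl fun p _ => by ring
  have e3 : a (m * n) - a m * a n = ((m : ℂ) * n) * (a (m * n) - a m * a n) := by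
    conv_lhs => rw [e1, e2, ← Finset.sum_sub_distrib]
    rw [Finset.sum_eq_single (m, n)]
    · ring
    · rintro ⟨d, e⟩ hp hne
      simp only [Finset.mem_product, Nat.mem_divisors] at hp
      obtain ⟨⟨hd, hm0⟩, he, hn0⟩ := hp
      have hdm := Nat.le_of_dvd hm hd
      have hen := Nat.le_of_dvd hn he
      have hlt : d * e < N := by
        rw [← hN]
        refine lt_of_le_of_ne (Nat.mul_le_mul hdm hen) fun h => hne ?_
        have h3 : d = m := by
          by_contra hh
          have : d < m := by omega
          nlinarith
        subst h3
        rw [Nat.eq_of_mul_eq_mul_left hm h]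
      simp only
      rw [ih _ hlt d e rfl (Nat.pos_of_dvd_of_pos hd hm) (Nat.pos_of_dvd_of_pos he hn)
        (Nat.Coprime.of_dvd hd he hc), sub_self]
    · intro h
      exact absurd (by simp; omega) h
  have h2 : ((m : ℂ) * n - 1) ≠ 0 := by
    rw [sub_ne_zero]
    exact_mod_cast h1
  have h3 : ((m : ℂ) * n - 1) * (a (m * n) - a m * a n) = 0 := by
    linear_combination -e3
  exact sub_eq_zero.mp ((mul_eq_zero.mp h3).resolve_left h2)
end

section
/- Let a : ℕ≥1 → ℂ satisfy a(1) = 1 and fix(a) = a, i.e. Σ_{d∣n} d·a(d) = a(n) for all n ≥ 1. Then for every n > 1 with prime factorization n = p₁^{r₁} ⋯ p_s^{r_s}, one has a(n) = ∏_{k=1}^{s} ∏_{ℓ=1}^{r_k} 1/(1 − p_k^{ℓ}); equivalently, a(n) = ∏_{p ∈ primeFactors(n)} ∏_{ℓ=1}^{v_p(n)} (1 − p^{ℓ})^{-1}, where v_p(n) is the p-adic valuation of n. -/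
open Complex Finset

noncomputable def locB (p k : ℕ) : ℂ := ∏ l ∈ Finset.Icc 1 k, (1 - (p : ℂ) ^ l)⁻¹

noncomputable def bFun : ArithmeticFunction ℂ :=
  ⟨fun n => if n = 0 then 0 else n.factorization.prod locB, by simp⟩

lemma bFun_apply {n : ℕ} (hn : n ≠ 0) : bFun n = n.factorization.prod locB := by
  simp [bFun, hn]

lemma bFun_mult : bFun.IsMultiplicative := by
  rw [ArithmeticFunction.IsMultiplicative.iff_ne_zero]
  refine ⟨by rw [bFun_apply one_ne_zero]; simp, ?_⟩
  intro m n hm hn hmn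
  rw [bFun_apply hm, bFun_apply hn, bFun_apply (mul_ne_zero hm hn),
    Nat.factorization_mul hm hn]
  exact Finsupp.prod_add_index_of_disjoint (Nat.Coprime.disjoint_primeFactors hmn) _

lemma bFun_pp {p : ℕ} (hp : p.Prime) (k : ℕ) : bFun (p ^ k) = locB p k := by
  rw [bFun_apply (pow_ne_zero _ hp.ne_zero), hp.factorization_pow,
    Finsupp.prod_single_index]
  simp [locB]

lemma one_sub_ne {n : ℕ} (hn : 1 < n) : (1 - (n : ℂ)) ≠ 0 := by
  intro h
  have : (n : ℂ) = 1 := (sub_eq_zero.mp h).symm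
  have : n = 1 := by exact_mod_cast this
  omega

lemma bFun_fix (n : ℕ) : ∑ d ∈ n.divisors, (d : ℂ) * bFun d = bFun n := by
  have hid : ((ArithmeticFunction.id : ArithmeticFunction ℕ) : ArithmeticFunction ℂ).IsMultiplicative :=
    ArithmeticFunction.isMultiplicative_id.natCast
  have hz : ((ArithmeticFunction.zeta : ArithmeticFunction ℕ) : ArithmeticFunction ℂ).IsMultiplicative :=
    ArithmeticFunction.isMultiplicative_zeta.natCast
  have hF := (hid.pmul bFun_mult).mul hz
  have h := (ArithmeticFunction.IsMultiplicative.eq_iff_eq_on_prime_powers _ hF _ bFun_mult).2 ?_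
  · have h2 := congrArg (fun f => f n) h
    simp only [ArithmeticFunction.coe_mul_zeta_apply] at h2
    simpa using h2
  · intro p k hp
    rw [ArithmeticFunction.coe_mul_zeta_apply, Nat.sum_divisors_prime_pow hp]
    simp only [ArithmeticFunction.pmul_apply, ArithmeticFunction.natCoe_apply,
      ArithmeticFunction.id_apply, bFun_pp hp]
    induction k with
    | zero => simp
    | succ k ih =>
      rw [Finset.sum_range_succ, ih]
      have h1 : locB p (k+1) = locB p k * (1 - (p : ℂ) ^ (k+1))⁻¹ := by
        unfold locB
        rw [Finset.prod_Icc_succ_top (by omega)]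
      have h0 := one_sub_ne (Nat.one_lt_pow (Nat.succ_ne_zero k) hp.one_lt)
      push_cast at h0 ⊢
      rw [h1]
      field_simp
      ring

theorem stmt3 (a : ℕ → ℂ) (ha1 : a 1 = 1)
    (hfix : ∀ n : ℕ, 1 ≤ n → ∑ d ∈ n.divisors, (d : ℂ) * a d = a n) :
    ∀ n : ℕ, 1 < n →
      a n = ∏ p ∈ n.primeFactors, ∏ ℓ ∈ Finset.Icc 1 (n.factorization p),
        (1 - (p : ℂ) ^ ℓ)⁻¹ := by
  have key : ∀ n : ℕ, 1 ≤ n → a n = bFun n := by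
    intro n
    induction n using Nat.strong_induction_on with
    | _ n ih =>
      intro hn
      rcases hn.eq_or_lt with rfl | hn1
      · rw [ha1, bFun_mult.1]
      · have e1 := hfix n hn
        have e2 := bFun_fix n
        rw [← Nat.cons_self_properDivisors (by omega), Finset.sum_cons] at e1 e2
        have e3 : ∑ d ∈ n.properDivisors, (d : ℂ) * a d
            = ∑ d ∈ n.properDivisors, (d : ℂ) * bFun d := by
          refine Finset.sum_congr rfl fun d hd => ?_
          rw [ih d (Nat.mem_properDivisors.1 hd).2 (Nat.pos_of_mem_properDivisors hd)]
        rw [e3] at e1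
        apply mul_left_cancel₀ (one_sub_ne hn1)
        linear_combination e2 - e1
  intro n hn
  rw [key n hn.le, bFun_apply (by omega)]
  rfl
end

section
/- Let a : ℕ≥1 → ℂ satisfy a(1) = 1 and fix(a) = a, i.e. Σ_{d∣n} d·a(d) = a(n) for all n ≥ 1. Then there exists a constant C > 0 such that |a(n)| ≤ C·log(log n)/n for all n ≥ 3. -/
open Complex Finset

lemma aux_mult (b : ℕ → ℂ) (hb1 : b 1 = 1)
    (hb : ∀ n : ℕ, 1 ≤ n → ∑ d ∈ n.divisors, b d = b n / n) :
    ∀ N : ℕ, ∀ m k : ℕ, m * k = N → 1 ≤ N → m.Coprime k → b (m * k) = b m * b k := by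
  intro N
  induction N using Nat.strong_induction_on with
  | _ N ih =>
  intro m k hN hN1 hmk
  have hm : 1 ≤ m := by
    rcases Nat.eq_zero_or_pos m with h | h
    · subst h; simp at hN; omega
    · exact h
  have hk : 1 ≤ k := by
    rcases Nat.eq_zero_or_pos k with h | h
    · subst h; simp at hN; omega
    · exact h
  by_cases h1 : N = 1
  · have hm1 : m = 1 := Nat.eq_one_of_mul_eq_one_right (hN.trans h1)
    subst hm1; simp [hb1]
  have e : ∑ d ∈ (m*k).divisors, b d = ∑ x ∈ m.divisors ×ˢ k.divisors, b (x.1 * x.2) := by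
    rw [Nat.divisors_mul, ← Finset.image_mul_product, Finset.sum_image]
    exact hmk.mul_injOn_divisors
  have e2 : ∑ x ∈ m.divisors ×ˢ k.divisors, (b (x.1 * x.2) - b x.1 * b x.2)
      = b (m * k) - b m * b k := by
    rw [Finset.sum_eq_single (m, k)]
    · rintro ⟨d, e⟩ hde hne
      simp only [Finset.mem_product, Nat.mem_divisors] at hde
      obtain ⟨⟨hd, -⟩, ⟨he, -⟩⟩ := hde
      have hd' := Nat.le_of_dvd hm hd
      have he' := Nat.le_of_dvd hk he
      have hd0 := Nat.pos_of_dvd_of_pos hd hm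
      have he0 := Nat.pos_of_dvd_of_pos he hk
      have hlt : d * e < N := by
        rw [← hN]
        rcases hd'.lt_or_eq with h | h
        · exact Nat.mul_lt_mul_of_lt_of_le h he' hk
        · rcases he'.lt_or_eq with h' | h'
          · exact Nat.mul_lt_mul_of_le_of_lt hd' h' hm
          · exact absurd (by rw [h, h']) hne
      have := ih (d*e) hlt d e rfl (Nat.mul_pos hd0 he0) (hmk.of_dvd hd he)
      simp [this]
    · intro h
      exact absurd (by simp [Finset.mem_product]; omega) h
  rw [Finset.sum_sub_distrib, ← e, Finset.sum_product, ← Finset.sum_mul_sum, hb m hm, hb k hk,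
    hb _ (by omega)] at e2
  have hmc : (m : ℂ) ≠ 0 := by exact_mod_cast (by omega : m ≠ 0)
  have hkc : (k : ℂ) ≠ 0 := by exact_mod_cast (by omega : k ≠ 0)
  have hmk1 : ((m : ℂ) * k - 1) ≠ 0 := by
    rw [sub_ne_zero]; exact_mod_cast (by omega : m * k ≠ 1)
  have e3 : ((m : ℂ) * k - 1) * (b (m * k) - b m * b k) = 0 := by
    push_cast at e2
    field_simp at e2
    linear_combination -e2
  rcases mul_eq_zero.mp e3 with h | h
  · exact absurd h hmk1
  · exact sub_eq_zero.mp h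

lemma aux_pp (b : ℕ → ℂ) (hb1 : b 1 = 1)
    (hb : ∀ n : ℕ, 1 ≤ n → ∑ d ∈ n.divisors, b d = b n / n) (p : ℕ) (hp : p.Prime) (j : ℕ) :
    ‖b (p ^ (j+1))‖ ≤ (1 - (p:ℝ)⁻¹)⁻¹ := by
  have hp2 : (2:ℝ) ≤ p := by exact_mod_cast hp.two_le
  have rec1 : ∀ j : ℕ, ‖b (p ^ (j+1))‖ = ‖b (p^j)‖ * (p / ((p:ℝ)^(j+1) - 1)) := by
    intro j
    have h1 := hb (p^j) (Nat.pow_pos hp.pos)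
    have h2 := hb (p^(j+1)) (Nat.pow_pos hp.pos)
    rw [Nat.sum_divisors_prime_pow hp] at h1 h2
    rw [Finset.sum_range_succ, h1] at h2
    have hpc : (p:ℂ) ≠ 0 := by exact_mod_cast hp.ne_zero
    have hlt : (1:ℝ) < (p:ℝ)^(j+1) := one_lt_pow₀ (by linarith) (by omega)
    have hne : (p:ℂ)^(j+1) - 1 ≠ 0 := by
      rw [sub_ne_zero]
      intro h
      have : (p:ℝ)^(j+1) = 1 := by exact_mod_cast h
      linarith
    have h3 : b (p^(j+1)) = -(b (p^j) * (p / ((p:ℂ)^(j+1) - 1))) := by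
      push_cast at h2
      have hP : (p:ℂ)^j ≠ 0 := pow_ne_zero _ hpc
      have h4 : b (p^j) * p + b (p^(j+1)) * (p:ℂ)^(j+1) = b (p^(j+1)) := by
        rw [eq_div_iff (pow_ne_zero _ hpc), add_mul, pow_succ (p:ℂ) j, div_mul_eq_mul_div,
          mul_left_comm, mul_div_cancel_left₀ _ hP] at h2
        rw [pow_succ (p:ℂ) j]
        exact h2
      rw [← mul_div_assoc, ← neg_div, eq_div_iff hne]
      linear_combination h4
    rw [h3, norm_neg, norm_mul, norm_div]
    congr 2
    · simp
    · have : (p:ℂ)^(j+1) - 1 = (((p:ℝ)^(j+1) - 1 : ℝ) : ℂ) := by push_cast; rfl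
      rw [this, Complex.norm_real, Real.norm_of_nonneg (by linarith)]
  induction j with
  | zero =>
    rw [rec1]
    simp only [pow_zero, hb1, norm_one, one_mul, zero_add, pow_one]
    apply le_of_eq
    have : (p:ℝ) - 1 ≠ 0 := by linarith
    field_simp
  | succ j ih =>
    rw [rec1]
    refine le_trans (mul_le_of_le_one_right (norm_nonneg _) ?_) ih
    have : (p:ℝ)^2 ≤ (p:ℝ)^(j+1+1) := pow_le_pow_right₀ (by linarith) (by omega)
    rw [div_le_one (by nlinarith)]
    nlinarith

lemma aux_bound (b : ℕ → ℂ) (hb1 : b 1 = 1)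
    (hb : ∀ n : ℕ, 1 ≤ n → ∑ d ∈ n.divisors, b d = b n / n) (n : ℕ) (hn : 1 ≤ n) :
    ‖b n‖ ≤ ∏ p ∈ n.primeFactors, (1 - (p:ℝ)⁻¹)⁻¹ := by
  induction n using Nat.recOnPosPrimePosCoprime with
  | zero => omega
  | one => simp [hb1]
  | prime_pow p j hp hj =>
    rw [Nat.primeFactors_prime_pow hj.ne' hp, Finset.prod_singleton]
    obtain ⟨i, rfl⟩ := Nat.exists_eq_succ_of_ne_zero hj.ne'
    exact aux_pp b hb1 hb p hp i
  | coprime m k hm hk hmk ihm ihk =>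
    rw [hmk.primeFactors_mul, Finset.prod_union hmk.disjoint_primeFactors,
      aux_mult b hb1 hb _ m k rfl hn hmk, norm_mul]
    have := ihm (by omega)
    exact mul_le_mul this (ihk (by omega)) (norm_nonneg _) ((norm_nonneg _).trans this)

lemma sum_log_le (n : ℕ) (hn : 1 ≤ n) : ∑ p ∈ n.primeFactors, Real.log p ≤ Real.log n := by
  rw [← Real.log_prod (fun p hp => by exact_mod_cast (Nat.prime_of_mem_primeFactors hp).ne_zero)]
  apply Real.log_le_log
  · exact Finset.prod_pos fun p hp => by exact_mod_cast (Nat.prime_of_mem_primeFactors hp).pos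
  · have h : ((∏ p ∈ n.primeFactors, p : ℕ) : ℝ) ≤ n :=
      Nat.cast_le.mpr (Nat.le_of_dvd hn (Nat.prod_primeFactors_dvd n))
    rwa [Nat.cast_prod] at h

lemma sum_log_div_le (N : ℕ) (hN : 1 ≤ N) :
    ∑ p ∈ (range (N+1)).filter Nat.Prime, Real.log p / p ≤ 2 * Real.log N := by
  have h1 : ∑ k ∈ range N, ∑ p ∈ (k+1).primeFactors, Real.log p ≤ N * Real.log N := by
    calc _ ≤ ∑ k ∈ range N, Real.log N := by
          apply Finset.sum_le_sum
          intro k hk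
          refine (sum_log_le _ (by omega)).trans (Real.log_le_log (by positivity) ?_)
          have := Finset.mem_range.mp hk
          exact_mod_cast this
      _ = _ := by simp
  have h2 : ∑ k ∈ range N, ∑ p ∈ (k+1).primeFactors, Real.log p
      = ∑ p ∈ (range (N+1)).filter Nat.Prime, ((N / p : ℕ) : ℝ) * Real.log p := by
    rw [Finset.sum_comm' (t' := (range (N+1)).filter Nat.Prime)
      (s' := fun p => (range N).filter (fun k => p ∣ k + 1))]
    · apply Finset.sum_congr rfl
      intro p _
      rw [Finset.sum_const, Nat.card_multiples, nsmul_eq_mul]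
    · intro k p
      simp only [Finset.mem_range, Nat.mem_primeFactors, Finset.mem_filter]
      constructor
      · rintro ⟨hk, hp, hd, -⟩
        have := Nat.le_of_dvd (by omega) hd
        exact ⟨⟨hk, hd⟩, by omega, hp⟩
      · rintro ⟨⟨hk, hd⟩, -, hp⟩
        exact ⟨hk, hp, hd, by omega⟩
  rw [h2] at h1
  have hNpos : (0:ℝ) < N := by exact_mod_cast hN
  have h3 : (N:ℝ) / 2 * ∑ p ∈ (range (N+1)).filter Nat.Prime, Real.log p / p ≤
      ∑ p ∈ (range (N+1)).filter Nat.Prime, ((N / p : ℕ) : ℝ) * Real.log p := by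
    rw [Finset.mul_sum]
    apply Finset.sum_le_sum
    intro p hp
    simp only [Finset.mem_range, Finset.mem_filter] at hp
    have hp0 : (0:ℝ) < p := by exact_mod_cast hp.2.pos
    have hlog : 0 ≤ Real.log p := Real.log_natCast_nonneg p
    have : (N:ℝ) ≤ 2 * p * (N / p : ℕ) := by
      have a1 := Nat.div_add_mod N p
      have a2 := Nat.mod_lt N hp.2.pos
      have a3 : 1 ≤ N / p := Nat.div_pos (by omega) hp.2.pos
      have a4 : p * 1 ≤ p * (N/p) := Nat.mul_le_mul_left _ a3
      have : N ≤ 2 * (p * (N / p)) := by omega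
      rw [mul_assoc]
      exact_mod_cast this
    have : (N:ℝ) / 2 / p ≤ (N / p : ℕ) := by
      rw [div_le_iff₀ hp0]; linarith
    calc (N:ℝ)/2 * (Real.log p / p) = (N:ℝ)/2/p * Real.log p := by ring
      _ ≤ _ := mul_le_mul_of_nonneg_right this hlog
  have := h3.trans h1
  have h4 : (N:ℝ) * (∑ p ∈ (range (N+1)).filter Nat.Prime, Real.log p / p) ≤ N * (2 * Real.log N) := by
    linarith
  exact le_of_mul_le_mul_left h4 hNpos

/-- sum over prime divisors -/
lemma sum_dvd (n : ℕ) (hn : 3 ≤ n) :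
    ∑ p ∈ n.primeFactors, Real.log p / p ≤ 2 * Real.log (Real.log n) + 1 := by
  have hn3 : (3:ℝ) ≤ n := by exact_mod_cast hn
  have hL : 1 ≤ Real.log n := by
    rw [Real.le_log_iff_exp_le (by linarith)]
    linarith [Real.exp_one_lt_d9]
  set L := Real.log n with hLdef
  set N := ⌊L⌋₊
  have hN : 1 ≤ N := Nat.le_floor (by simpa using hL)
  have key : ∀ p ∈ n.primeFactors, Real.log p / p ≤
      (if p ∈ (range (N+1)).filter Nat.Prime then Real.log p / p else 0) + Real.log p / L := by
    intro p hp
    have hpp := Nat.prime_of_mem_primeFactors hp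
    have hlog : 0 ≤ Real.log p := Real.log_natCast_nonneg p
    split_ifs with h
    · have : 0 ≤ Real.log p / L := by positivity
      linarith
    · have : L ≤ p := by
        by_contra hc
        apply h
        simp only [Finset.mem_filter, Finset.mem_range]
        exact ⟨Nat.lt_succ_of_le (Nat.le_floor (not_le.mp hc).le), hpp⟩
      rw [zero_add]
      exact div_le_div_of_nonneg_left hlog (by linarith) this
  refine (Finset.sum_le_sum key).trans ?_
  rw [Finset.sum_add_distrib, ← Finset.sum_div]
  have t1 : ∑ p ∈ n.primeFactors, (if p ∈ (range (N+1)).filter Nat.Prime then Real.log p / p else (0:ℝ))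
      ≤ 2 * Real.log L := by
    rw [← Finset.sum_filter]
    refine (Finset.sum_le_sum_of_subset_of_nonneg (t := (range (N+1)).filter Nat.Prime) ?_ ?_).trans
      ((sum_log_div_le N hN).trans ?_)
    · intro p hp; exact (Finset.mem_filter.mp hp).2
    · intro p _ _
      have hlog : 0 ≤ Real.log p := Real.log_natCast_nonneg p
      positivity
    · have : Real.log N ≤ Real.log L :=
        Real.log_le_log (by exact_mod_cast hN) (Nat.floor_le (by linarith))
      linarith
  have t2 : (∑ p ∈ n.primeFactors, Real.log p) / L ≤ 1 := by
    rw [div_le_one (by linarith)]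
    exact sum_log_le n (by omega)
  linarith

lemma euler_le (s : ℝ) (hs : 1 < s) (S : Finset ℕ) (hS : ∀ p ∈ S, p.Prime) :
    ∏ p ∈ S, (1 - (p:ℝ) ^ (-s))⁻¹ ≤ ∑' n : ℕ, 1 / (n:ℝ)^s := by
  let f : ℕ →* ℝ :=
    { toFun := fun n => (n:ℝ)^(-s)
      map_one' := by simp
      map_mul' := fun m n => by
        push_cast
        exact Real.mul_rpow (Nat.cast_nonneg _) (Nat.cast_nonneg _) }
  have hf : ∀ n, f n = (n:ℝ)^(-s) := fun n => rfl
  have hsum : Summable f := by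
    show Summable (fun n : ℕ => (n:ℝ)^(-s))
    exact Real.summable_nat_rpow.mpr (by linarith)
  have h := EulerProduct.prod_filter_prime_geometric_eq_tsum_factoredNumbers hsum S
  rw [Finset.filter_true_of_mem hS] at h
  simp only [hf] at h
  rw [h]
  have hc : ∀ n : ℕ, 1 / (n:ℝ)^s = f n := fun n => by
    rw [hf, Real.rpow_neg (Nat.cast_nonneg _), one_div]
  simp only [hc]
  have hnn : ∀ n, 0 ≤ f n := fun n => Real.rpow_nonneg (Nat.cast_nonneg n) _
  exact Summable.tsum_subtype_le (fun n => f n) (Nat.factoredNumbers S) hnn hsum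

lemma ratio_le (σ : ℝ) (hσ : 0 < σ) (p : ℕ) (hp : p.Prime) :
    (1 - (p:ℝ)⁻¹)⁻¹ ≤ (1 - (p:ℝ) ^ (-(1+σ)))⁻¹ * Real.exp (2 * σ * (Real.log p / p)) := by
  have hp2 : (2:ℝ) ≤ p := by exact_mod_cast hp.two_le
  have hp0 : (0:ℝ) < p := by linarith
  have e1 : (p:ℝ) ^ (-(1+σ)) = (p:ℝ)⁻¹ * Real.exp (-(σ * Real.log p)) := by
    rw [neg_add, Real.rpow_add hp0, Real.rpow_neg_one, Real.rpow_def_of_pos hp0]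
    congr 2; ring
  set u := (p:ℝ)⁻¹ with hu
  have hu0 : 0 < u := by positivity
  have hu2 : u ≤ 1/2 := by rw [hu, one_div]; exact inv_anti₀ (by norm_num) hp2
  set t := σ * Real.log p with ht
  have ht0 : 0 < t := mul_pos hσ (Real.log_pos (by linarith))
  have h1 : 1 - t ≤ Real.exp (-t) := by linarith [Real.add_one_le_exp (-t)]
  have h2 : Real.exp (-t) ≤ 1 := Real.exp_le_one_iff.mpr (by linarith)
  have e2 : 2 * σ * (Real.log p / p) = 2 * t * u := by rw [ht, hu]; ring
  rw [e1, e2]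
  have h3 : 1 + 2*t*u ≤ Real.exp (2*t*u) := by linarith [Real.add_one_le_exp (2*t*u)]
  have hpos : 0 < 1 - u * Real.exp (-t) := by nlinarith
  rw [inv_mul_eq_div, le_div_iff₀ hpos, inv_mul_le_iff₀ (by linarith)]
  have : 1 - u * Real.exp (-t) ≤ (1 - u) * (1 + 2*t*u) := by
    have : u * (1 - t) ≤ u * Real.exp (-t) := mul_le_mul_of_nonneg_left h1 hu0.le
    have : 0 ≤ (t * u) * (1 - 2 * u) := mul_nonneg (by positivity) (by linarith)
    nlinarith
  exact this.trans (mul_le_mul_of_nonneg_left h3 (by linarith))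

lemma final (n : ℕ) (hn : 3 ≤ n) (hL : 1 ≤ Real.log (Real.log n)) 
    (hz : (1 + (Real.log (Real.log n))⁻¹ - 1) * ∑' k : ℕ, 1 / (k:ℝ)^(1 + (Real.log (Real.log n))⁻¹) < 2) :
    ∏ p ∈ n.primeFactors, (1 - (p:ℝ)⁻¹)⁻¹ ≤ (2 * Real.exp 6) * Real.log (Real.log n) := by
  have hsd := sum_dvd n hn
  set M := Real.log (Real.log n)
  have hM : 0 < M := by linarith
  have hσ : 0 < M⁻¹ := by positivity
  have hpr : ∀ p ∈ n.primeFactors, p.Prime := fun p hp => Nat.prime_of_mem_primeFactors hp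
  have h1 : ∏ p ∈ n.primeFactors, (1 - (p:ℝ)⁻¹)⁻¹ ≤
      ∏ p ∈ n.primeFactors, ((1 - (p:ℝ) ^ (-(1+M⁻¹)))⁻¹ * Real.exp (2 * M⁻¹ * (Real.log p / p))) := by
    apply Finset.prod_le_prod
    · intro p hp
      have : (2:ℝ) ≤ p := by exact_mod_cast (hpr p hp).two_le
      have : (p:ℝ)⁻¹ ≤ 1 := inv_le_one_of_one_le₀ (by linarith)
      exact inv_nonneg.mpr (by linarith)
    · intro p hp
      exact ratio_le _ hσ p (hpr p hp)
  rw [Finset.prod_mul_distrib, ← Real.exp_sum, ← Finset.mul_sum] at h1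
  have h2 := euler_le (1+M⁻¹) (by linarith) _ hpr
  have h3 : ∑' k : ℕ, 1 / (k:ℝ)^(1 + M⁻¹) ≤ 2 * M := by
    rw [add_sub_cancel_left, inv_mul_lt_iff₀ hM] at hz
    linarith
  have h4 : 2 * M⁻¹ * ∑ p ∈ n.primeFactors, Real.log p / p ≤ 6 := by
    have : 2 * M⁻¹ * ∑ p ∈ n.primeFactors, Real.log p / p ≤ 2 * M⁻¹ * (3 * M) := 
      mul_le_mul_of_nonneg_left (by linarith) (by positivity)
    have e : 2 * M⁻¹ * (3 * M) = 6 := by field_simp; norm_num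
    linarith
  refine h1.trans ((mul_le_mul (h2.trans h3) (Real.exp_le_exp.mpr h4) (Real.exp_pos _).le (by positivity)).trans ?_)
  apply le_of_eq; ring

open Filter Topology in
lemma ev_bound : ∃ N : ℕ, ∀ n : ℕ, N ≤ n →
    ∏ p ∈ n.primeFactors, (1 - (p:ℝ)⁻¹)⁻¹ ≤ (2 * Real.exp 6) * Real.log (Real.log n) := by
  have hT : Tendsto (fun n : ℕ => Real.log (Real.log n)) atTop atTop :=
    Real.tendsto_log_atTop.comp (Real.tendsto_log_atTop.comp tendsto_natCast_atTop_atTop)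
  have hS : Tendsto (fun n : ℕ => 1 + (Real.log (Real.log n))⁻¹) atTop (𝓝[>] 1) := by
    rw [tendsto_nhdsWithin_iff]
    refine ⟨by simpa using (tendsto_inv_atTop_zero.comp hT).const_add 1, ?_⟩
    filter_upwards [hT.eventually_gt_atTop 0] with n hn
    simpa using hn
  have h := (tendsto_sub_mul_tsum_nat_rpow.comp hS).eventually_lt_const (by norm_num : (1:ℝ) < 2)
  have := (h.and (hT.eventually_ge_atTop 1)).and (eventually_ge_atTop 3)
  obtain ⟨N, hN⟩ := eventually_atTop.mp this
  exact ⟨N, fun n hn => final n (hN n hn).2 (hN n hn).1.2 (hN n hn).1.1⟩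

theorem stmt5 (a : ℕ → ℂ) (ha1 : a 1 = 1)
    (hfix : ∀ n : ℕ, 1 ≤ n → ∑ d ∈ n.divisors, (d : ℂ) * a d = a n) :
    ∃ C : ℝ, 0 < C ∧ ∀ n : ℕ, 3 ≤ n →
      ‖a n‖ ≤ C * Real.log (Real.log n) / n := by
  obtain ⟨N, hN⟩ := ev_bound
  have hb := aux_bound (fun n => (n:ℂ) * a n) (by simp [ha1]) (fun n hn => by
    have : (n:ℂ) ≠ 0 := by exact_mod_cast (by omega : n ≠ 0)
    rw [hfix n hn]; field_simp)
  have hMpos : ∀ n : ℕ, 3 ≤ n → 0 < Real.log (Real.log n) := by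
    intro n hn
    have hn3 : (3:ℝ) ≤ n := by exact_mod_cast hn
    apply Real.log_pos
    rw [Real.lt_log_iff_exp_lt (by linarith)]
    linarith [Real.exp_one_lt_d9]
  set F : ℕ → ℝ := fun m => |(m:ℝ) * ‖a m‖ / Real.log (Real.log m)|
  have hF : 0 ≤ ∑ m ∈ range N, F m := Finset.sum_nonneg fun _ _ => abs_nonneg _
  refine ⟨2 * Real.exp 6 + ∑ m ∈ range N, F m, by positivity, fun n hn => ?_⟩
  have hM := hMpos n hn
  have hn0 : (0:ℝ) < n := by exact_mod_cast (by omega : 0 < n)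
  rw [le_div_iff₀ hn0]
  rcases le_or_gt N n with h | h
  · have h1 := hb n (by omega)
    rw [norm_mul, Complex.norm_natCast] at h1
    have h2 := hN n h
    have := mul_nonneg hF hM.le
    linarith
  · have h1 : F n ≤ ∑ m ∈ range N, F m :=
      Finset.single_le_sum (f := F) (fun _ _ => abs_nonneg _) (Finset.mem_range.mpr h)
    have h2 : (n:ℝ) * ‖a n‖ / Real.log (Real.log n) ≤ ∑ m ∈ range N, F m := (le_abs_self _).trans h1
    rw [div_le_iff₀ hM] at h2
    have := mul_nonneg (by positivity : 0 ≤ 2 * Real.exp 6) hM.le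
    linarith
end

section
/- Let a : ℕ≥1 → ℂ satisfy a(1) = 1 and fix(a) = a, i.e. Σ_{d∣n} d·a(d) = a(n) for all n ≥ 1. Then for every s ∈ ℂ with Re(s) > 1 the Dirichlet series D_a(s) = Σ_{m≥1} a(m)/m^s converges absolutely. -/
open Complex Finset

lemma div_split (p : ℕ) (hp : p.Prime) (k m : ℕ) (hm : 1 ≤ m) (hpm : ¬ p ∣ m) (f : ℕ → ℂ) :
    ∑ d ∈ (p ^ (k+1) * m).divisors, f d
      = ∑ d ∈ (p ^ k * m).divisors, f d + ∑ d ∈ m.divisors, f (p ^ (k+1) * d) := by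
  have hp0 : 0 < p := hp.pos
  have hinj : Function.Injective (fun d => p ^ (k+1) * d) :=
    fun x y h => Nat.eq_of_mul_eq_mul_left (pow_pos hp0 (k+1)) h
  have himg : ∑ d ∈ m.divisors, f (p ^ (k+1) * d)
      = ∑ d ∈ m.divisors.image (fun d => p ^ (k+1) * d), f d := by
    rw [Finset.sum_image (fun x _ y _ h => hinj h)]
  have hdisj : Disjoint (p ^ k * m).divisors (m.divisors.image (fun d => p ^ (k+1) * d)) := by
    rw [Finset.disjoint_left]
    intro d hd hd2
    simp only [Finset.mem_image, Nat.mem_divisors] at hd hd2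
    obtain ⟨e, he, rfl⟩ := hd2
    apply hpm
    have h1 : p ^ k * p ∣ p ^ k * m := by
      rw [← pow_succ]; exact (Dvd.intro _ rfl).trans hd.1
    exact Nat.dvd_of_mul_dvd_mul_left (pow_pos hp0 k) h1
  rw [himg, ← Finset.sum_union hdisj]
  congr 1
  ext d
  simp only [Finset.mem_union, Finset.mem_image, Nat.mem_divisors]
  have hm0 : m ≠ 0 := by omega
  have hpk : ∀ j, p ^ j * m ≠ 0 := fun j => Nat.mul_ne_zero (pow_pos hp0 _).ne' hm0
  constructor
  · rintro ⟨hd, -⟩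
    obtain ⟨x, y, hx, hy, rfl⟩ := (Nat.dvd_mul).1 hd
    obtain ⟨j, hj, rfl⟩ := (Nat.dvd_prime_pow hp).1 hx
    rcases Nat.lt_or_ge j (k+1) with h | h
    · left
      exact ⟨Nat.mul_dvd_mul (pow_dvd_pow p (by omega)) hy, hpk k⟩
    · right
      have : j = k + 1 := by omega
      subst this
      exact ⟨y, ⟨hy, hm0⟩, rfl⟩
  · rintro (⟨hd, -⟩ | ⟨e, ⟨he, -⟩, rfl⟩)
    · exact ⟨hd.trans (Nat.mul_dvd_mul (pow_dvd_pow p (by omega)) dvd_rfl), hpk _⟩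
    · exact ⟨Nat.mul_dvd_mul dvd_rfl he, hpk _⟩

lemma zero_of_eigen (p : ℕ) (c : ℂ) (hc : ∀ n : ℕ, 1 ≤ n → c * n ≠ 1) (g : ℕ → ℂ)
    (hg : ∀ m : ℕ, 1 ≤ m → ¬ p ∣ m → c * ∑ d ∈ m.divisors, (d : ℂ) * g d = g m) :
    ∀ m : ℕ, 1 ≤ m → ¬ p ∣ m → g m = 0 := by
  intro m
  induction m using Nat.strong_induction_on with
  | _ m ih =>
    intro hm hpm
    have h := hg m hm hpm
    have h0 : ∑ d ∈ m.divisors, (d : ℂ) * g d = m * g m := by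
      apply Finset.sum_eq_single_of_mem m (by simp; omega)
      intro d hd hne
      have hdm := Nat.dvd_of_mem_divisors hd
      have hle := Nat.le_of_dvd (by omega) hdm
      rw [ih d (by omega) (Nat.pos_of_mem_divisors hd) (fun h => hpm (h.trans hdm)), mul_zero]
    rw [h0] at h
    have h2 : (c * m - 1) * g m = 0 := by linear_combination h
    rcases mul_eq_zero.1 h2 with h3 | h3
    · exact absurd (sub_eq_zero.1 h3) (hc m hm)
    · exact h3

lemma pow_ne (p : ℕ) (hp : p.Prime) (k n : ℕ) (hn : 1 ≤ n) : (p : ℂ) ^ (k+1) * n ≠ 1 := by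
  intro h
  have h' : p ^ (k+1) * n = 1 := by exact_mod_cast h
  have h2 : p ^ (k+1) = 1 := Nat.eq_one_of_mul_eq_one_right h'
  have h3 : 1 < p ^ (k+1) := Nat.one_lt_pow (Nat.succ_ne_zero k) hp.one_lt
  omega

lemma euler_step (a : ℕ → ℂ)
    (hfix : ∀ n : ℕ, 1 ≤ n → ∑ d ∈ n.divisors, (d : ℂ) * a d = a n)
    (p : ℕ) (hp : p.Prime) (k : ℕ)
    (hk : ∀ m : ℕ, 1 ≤ m → ¬ p ∣ m → ∑ d ∈ m.divisors, (d : ℂ) * a (p ^ k * d) = a (p ^ k * m)) :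
    ∀ m : ℕ, 1 ≤ m → ¬ p ∣ m →
      (1 - (p : ℂ) ^ (k+1)) * a (p ^ (k+1) * m) - a (p ^ k * m) = 0 := by
  apply zero_of_eigen p ((p : ℂ) ^ (k+1)) (pow_ne p hp k)
    (fun m => (1 - (p : ℂ) ^ (k+1)) * a (p ^ (k+1) * m) - a (p ^ k * m))
  intro m hm hpm
  have hpos : ∀ j, 1 ≤ p ^ j * m := fun j => Nat.mul_pos (pow_pos hp.pos _) hm
  have h1 := div_split p hp k m hm hpm (fun d => (d : ℂ) * a d)
  rw [hfix _ (hpos _), hfix _ (hpos _)] at h1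
  have h2 : ∑ d ∈ m.divisors, ((p ^ (k+1) * d : ℕ) : ℂ) * a (p ^ (k+1) * d)
      = (p : ℂ) ^ (k+1) * ∑ d ∈ m.divisors, (d : ℂ) * a (p ^ (k+1) * d) := by
    rw [Finset.mul_sum]
    refine Finset.sum_congr rfl fun d _ => ?_
    push_cast; ring
  rw [h2] at h1
  have h3 : ∑ d ∈ m.divisors, (d : ℂ) *
        ((1 - (p : ℂ) ^ (k+1)) * a (p ^ (k+1) * d) - a (p ^ k * d))
      = (1 - (p : ℂ) ^ (k+1)) * ∑ d ∈ m.divisors, (d : ℂ) * a (p ^ (k+1) * d)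
        - ∑ d ∈ m.divisors, (d : ℂ) * a (p ^ k * d) := by
    rw [Finset.mul_sum, ← Finset.sum_sub_distrib]
    refine Finset.sum_congr rfl fun d _ => ?_
    ring
  rw [h3, hk m hm hpm]
  linear_combination (-(1 - (p : ℂ) ^ (k+1))) * h1

lemma euler_fix (a : ℕ → ℂ)
    (hfix : ∀ n : ℕ, 1 ≤ n → ∑ d ∈ n.divisors, (d : ℂ) * a d = a n)
    (p : ℕ) (hp : p.Prime) (k : ℕ) :
    ∀ m : ℕ, 1 ≤ m → ¬ p ∣ m →
      ∑ d ∈ m.divisors, (d : ℂ) * a (p ^ k * d) = a (p ^ k * m) := by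
  induction k with
  | zero => intro m hm _; simpa using hfix m hm
  | succ k ih =>
    intro m hm hpm
    have hs := euler_step a hfix p hp k ih
    have hne : (1 - (p : ℂ) ^ (k+1)) ≠ 0 := by
      intro h
      apply pow_ne p hp k 1 le_rfl
      push_cast
      linear_combination -h
    apply mul_left_cancel₀ hne
    rw [Finset.mul_sum, sub_eq_zero.1 (hs m hm hpm), ← ih m hm hpm]
    refine Finset.sum_congr rfl fun d hd => ?_
    have hdm := Nat.dvd_of_mem_divisors hd
    linear_combination (d : ℂ) * hs d (Nat.pos_of_mem_divisors hd) (fun h => hpm (h.trans hdm))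

lemma a_bound (a : ℕ → ℂ) (ha1 : a 1 = 1)
    (hfix : ∀ n : ℕ, 1 ≤ n → ∑ d ∈ n.divisors, (d : ℂ) * a d = a n) :
    ∀ n : ℕ, 1 ≤ n → ‖a n‖ ≤ 1 := by
  intro n
  induction n using Nat.strong_induction_on with
  | _ n ih =>
    intro hn
    rcases eq_or_ne n 1 with rfl | hn1
    · simp [ha1]
    have hp := Nat.minFac_prime hn1
    have hdvd := Nat.minFac_dvd n
    generalize n.minFac = p at hp hdvd
    obtain ⟨j, m, hpm, hnm⟩ := Nat.exists_eq_pow_mul_and_not_dvd (by omega : n ≠ 0) p hp.ne_one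
    cases j with
    | zero => simp at hnm; subst hnm; exact absurd hdvd hpm
    | succ k =>
      have hm : 1 ≤ m := by
        rcases Nat.eq_zero_or_pos m with rfl | h
        · simp at hpm
        · exact h
      have hs := sub_eq_zero.1 (euler_step a hfix p hp k (euler_fix a hfix p hp k) m hm hpm)
      rw [← hnm] at hs
      have hpos : 1 ≤ p ^ k * m := Nat.mul_pos (pow_pos hp.pos _) hm
      have hlt : p ^ k * m < n := by
        rw [hnm, pow_succ, mul_assoc, mul_left_comm]
        nlinarith [hp.two_le]
      have hb := ih _ hlt hpos
      rw [← hs, norm_mul] at hb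
      have h1 : (1:ℝ) ≤ ‖1 - (p : ℂ) ^ (k+1)‖ := by
        have h2 : 2 ≤ p ^ (k+1) := Nat.one_lt_pow (Nat.succ_ne_zero k) hp.one_lt
        have h3 : (2:ℝ) ≤ (p:ℝ) ^ (k+1) := by exact_mod_cast h2
        rw [norm_sub_rev]
        have h4 := norm_sub_norm_le ((p : ℂ) ^ (k+1)) 1
        rw [norm_pow, norm_one, Complex.norm_natCast] at h4
        linarith
      nlinarith [norm_nonneg (a n)]

theorem stmt6 (a : ℕ → ℂ) (ha1 : a 1 = 1)
    (hfix : ∀ n : ℕ, 1 ≤ n → ∑ d ∈ n.divisors, (d : ℂ) * a d = a n) :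
    ∀ s : ℂ, 1 < s.re → Summable (fun m : ℕ+ => ‖a m / (m : ℂ) ^ s‖) := by
  intro s hs
  have h := (Real.summable_one_div_nat_rpow.2 hs).comp_injective PNat.coe_injective
  refine Summable.of_nonneg_of_le (fun _ => norm_nonneg _) (fun m => ?_) h
  rw [norm_div, Complex.norm_natCast_cpow_of_pos m.pos]
  simp only [Function.comp]
  gcongr
  exact a_bound a ha1 hfix m m.pos
end

section
/- Let a : ℕ≥1 → ℂ satisfy a(1) = 1 and fix(a) = a, i.e. Σ_{d∣n} d·a(d) = a(n) for all n ≥ 1, and let D_a(s) = Σ_{m≥1} a(m)/m^s. Then for every s ∈ ℂ with Re(s) > 1, the infinite product ∏_{ℓ=1}^{∞} ζ(s+ℓ)^{-1} converges and D_a(s) = ∏_{ℓ=1}^{∞} ζ(s+ℓ)^{-1} = ∏_{p prime} ∏_{ℓ≥1} (1 − p^{-(s+ℓ)}), where ζ is the Riemann zeta function. -/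
open Complex Finset

lemma aux_bound_s8 (a : ℕ → ℂ) (ha1 : a 1 = 1)
    (hfix : ∀ n : ℕ, 1 ≤ n → ∑ d ∈ n.divisors, (d : ℂ) * a d = a n) :
    ∀ n : ℕ, n ≠ 0 → ‖a n‖ ≤ 1 := by
  have hmob := (ArithmeticFunction.sum_eq_iff_sum_mul_moebius_eq
    (f := fun d : ℕ => (d : ℂ) * a d) (g := a)).1 (fun n hn => hfix n hn)
  intro n
  induction n using Nat.strong_induction_on with
  | _ n ih =>
    intro hn
    rcases eq_or_ne n 1 with rfl | h1
    · simp [ha1]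
    have hn2 : 2 ≤ n := by omega
    have h := hmob n (by omega)
    rw [Nat.sum_divisorsAntidiagonal' (f := fun x y => ((ArithmeticFunction.moebius x : ℤ) : ℂ) * a y),
      ← Nat.cons_self_properDivisors hn, Finset.sum_cons] at h
    rw [Nat.div_self (by omega)] at h
    simp only [ArithmeticFunction.moebius_apply_one, Int.cast_one, one_mul] at h
    have h2 : ((n : ℂ) - 1) * a n =
        ∑ d ∈ n.properDivisors, ((ArithmeticFunction.moebius (n / d) : ℤ) : ℂ) * a d := by
      linear_combination -h
    have h3 : ‖∑ d ∈ n.properDivisors, ((ArithmeticFunction.moebius (n / d) : ℤ) : ℂ) * a d‖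
        ≤ ∑ d ∈ n.properDivisors, (1 : ℝ) := by
      refine norm_sum_le_of_le _ (fun d hd => ?_)
      have hd' := Nat.mem_properDivisors.1 hd
      rw [norm_mul]
      have e1 : ‖((ArithmeticFunction.moebius (n / d) : ℤ) : ℂ)‖ ≤ 1 := by
        rw [Complex.norm_intCast]
        exact_mod_cast ArithmeticFunction.abs_moebius_le_one
      have e2 := ih d hd'.2 (Nat.pos_of_mem_properDivisors hd).ne'
      exact mul_le_one₀ e1 (norm_nonneg _) e2
    rw [← h2, norm_mul, Finset.sum_const, nsmul_eq_mul, mul_one] at h3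
    have h4 : ‖(n : ℂ) - 1‖ = (n : ℝ) - 1 := by
      have : (n : ℂ) - 1 = (((n : ℝ) - 1 : ℝ) : ℂ) := by push_cast; rfl
      rw [this, Complex.norm_real, Real.norm_of_nonneg]
      have : (2 : ℝ) ≤ n := by exact_mod_cast hn2
      linarith
    have h5 : ((n.properDivisors.card : ℕ) : ℝ) ≤ (n : ℝ) - 1 := by
      have := Nat.card_divisors_le_self n
      rw [← Nat.cons_self_properDivisors hn, Finset.card_cons] at this
      have : ((n.properDivisors.card + 1 : ℕ) : ℝ) ≤ n := by exact_mod_cast this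
      push_cast at this
      linarith
    have hpos : (0 : ℝ) < (n : ℝ) - 1 := by
      have : (2 : ℝ) ≤ n := by exact_mod_cast hn2
      linarith
    rw [h4] at h3
    by_contra hc
    push Not at hc
    nlinarith

lemma aux_step (a : ℕ → ℂ) (ha1 : a 1 = 1)
    (hfix : ∀ n : ℕ, 1 ≤ n → ∑ d ∈ n.divisors, (d : ℂ) * a d = a n) (s : ℂ) (hs : 1 < s.re) :
    LSeries a s = (riemannZeta (s + 1))⁻¹ * LSeries a (s + 1) := by
  have hs1 : 1 < (s + 1).re := by simp; linarith
  have hb := aux_bound_s8 a ha1 hfix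
  have hsum : LSeriesSummable a s := LSeriesSummable_of_bounded_of_one_lt_re hb hs
  have hterm : LSeries.term (fun d : ℕ => (d : ℂ) * a d) (s + 1) = LSeries.term a s := by
    ext n
    rcases eq_or_ne n 0 with rfl | hn
    · simp
    have hn' : (n : ℂ) ≠ 0 := by exact_mod_cast hn
    rw [LSeries.term_of_ne_zero hn, LSeries.term_of_ne_zero hn, Complex.cpow_add _ _ hn',
      Complex.cpow_one]
    have : (n : ℂ) ^ s ≠ 0 := by simp [Complex.cpow_eq_zero_iff, hn']
    field_simp
  have hsum' : LSeriesSummable (fun d : ℕ => (d : ℂ) * a d) (s + 1) := by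
    unfold LSeriesSummable
    rw [hterm]; exact hsum
  have hconv := LSeries_convolution' hsum' (LSeriesSummable_one_iff.2 hs1)
  have hL : LSeries (fun d : ℕ => (d : ℂ) * a d) (s + 1) = LSeries a s := by
    unfold LSeries
    rw [hterm]
  have hc : LSeries (LSeries.convolution (fun d : ℕ => (d : ℂ) * a d) 1) (s + 1) = LSeries a (s + 1) := by
    apply LSeries_congr
    intro n hn
    rw [LSeries.convolution_def]
    simp only [Pi.one_apply, mul_one]
    rw [Nat.sum_divisorsAntidiagonal (f := fun x _ => (x : ℂ) * a x)]
    exact hfix n (by omega)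
  rw [hc, hL, LSeries_one_eq_riemannZeta hs1] at hconv
  have hz := riemannZeta_ne_zero_of_one_lt_re hs1
  rw [hconv]
  field_simp

open Filter Topology in
lemma aux_tendsto (a : ℕ → ℂ) (ha1 : a 1 = 1)
    (hfix : ∀ n : ℕ, 1 ≤ n → ∑ d ∈ n.divisors, (d : ℂ) * a d = a n) (s : ℂ) (hs : 1 < s.re) :
    Tendsto (fun N : ℕ => LSeries a (s + N)) atTop (𝓝 1) := by
  have hb := aux_bound_s8 a ha1 hfix
  have hsum : LSeriesSummable a s := LSeriesSummable_of_bounded_of_one_lt_re hb hs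
  let f : ℕ → ℂ := fun n => a n / (n : ℂ) ^ s
  have hterm : ∀ w : ℂ, LSeries.term f w = LSeries.term a (s + w) := by
    intro w
    ext n
    rcases eq_or_ne n 0 with rfl | hn
    · simp
    have hn' : (n : ℂ) ≠ 0 := by exact_mod_cast hn
    rw [LSeries.term_of_ne_zero hn, LSeries.term_of_ne_zero hn, Complex.cpow_add _ _ hn', div_div]
  have hf0 : LSeriesSummable f 0 := by
    unfold LSeriesSummable
    rw [hterm, add_zero]; exact hsum
  have hab : LSeries.abscissaOfAbsConv f < ⊤ :=
    lt_of_le_of_lt hf0.abscissaOfAbsConv_le (EReal.coe_lt_top _)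
  have := (LSeries.tendsto_atTop hab).comp (tendsto_natCast_atTop_atTop (R := ℝ))
  have h1 : f 1 = 1 := by simp [f, ha1]
  rw [h1] at this
  refine this.congr (fun N => ?_)
  simp only [Function.comp_apply, LSeries, hterm]
  simp

lemma aux_iter (a : ℕ → ℂ) (ha1 : a 1 = 1)
    (hfix : ∀ n : ℕ, 1 ≤ n → ∑ d ∈ n.divisors, (d : ℂ) * a d = a n) (s : ℂ) (hs : 1 < s.re)
    (N : ℕ) :
    LSeries a s = (∏ l ∈ Finset.range N, (riemannZeta (s + (l + 1)))⁻¹) * LSeries a (s + N) := by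
  induction N with
  | zero => simp
  | succ N ih =>
    have hN : 1 < (s + N).re := by
      have : (0 : ℝ) ≤ N := N.cast_nonneg
      simp; linarith
    rw [ih, Finset.prod_range_succ, aux_step a ha1 hfix (s + N) hN]
    push_cast
    rw [← add_assoc s, mul_assoc]

lemma aux_summable (s : ℂ) (hs : 1 < s.re) :
    Summable (fun x : Nat.Primes × ℕ => -((x.1 : ℕ) : ℂ) ^ (-(s + (x.2 + 1)))) := by
  have h1 : Summable (fun p : Nat.Primes => ((p : ℕ) : ℝ) ^ (-(s.re + 1))) :=
    Nat.Primes.summable_rpow.2 (by linarith)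
  have h2 : Summable (fun l : ℕ => ((1 : ℝ) / 2) ^ l) := summable_geometric_two
  refine Summable.of_norm_bounded (h1.mul_of_nonneg h2 (fun p => by positivity)
    (fun l => by positivity)) ?_
  rintro ⟨p, l⟩
  have hp : 0 < (p : ℕ) := p.2.pos
  have hp2 : (2 : ℝ) ≤ ((p : ℕ) : ℝ) := by exact_mod_cast p.2.two_le
  rw [norm_neg, Complex.norm_natCast_cpow_of_pos hp]
  have e : (-(s + ((l : ℂ) + 1))).re = -(s.re + 1) + -(l : ℝ) := by simp; ring
  simp only [e]
  rw [Real.rpow_add (by positivity), Real.rpow_neg (by positivity) (l : ℝ), Real.rpow_natCast,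
    one_div, inv_pow]
  gcongr

theorem stmt8 (a : ℕ → ℂ) (ha1 : a 1 = 1)
    (hfix : ∀ n : ℕ, 1 ≤ n → ∑ d ∈ n.divisors, (d : ℂ) * a d = a n) :
    ∀ s : ℂ, 1 < s.re →
      Multipliable (fun ℓ : ℕ => (riemannZeta (s + (ℓ + 1)))⁻¹) ∧
      (∑' m : ℕ+, a m / (m : ℂ) ^ s) = ∏' ℓ : ℕ, (riemannZeta (s + (ℓ + 1)))⁻¹ ∧
      (∑' m : ℕ+, a m / (m : ℂ) ^ s) =
        ∏' (p : Nat.Primes) (ℓ : ℕ), (1 - ((p : ℕ) : ℂ) ^ (-(s + (ℓ + 1)))) := by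
  intro s hs
  have hsum := aux_summable s hs
  have hmul := Complex.multipliable_one_add_of_summable hsum
  have hF := hmul.hasProd
  set F := ∏' x : Nat.Primes × ℕ, (1 + -((x.1 : ℕ) : ℂ) ^ (-(s + (x.2 + 1)))) with hFdef
  have hA : HasProd (fun ℓ : ℕ => (riemannZeta (s + (ℓ + 1)))⁻¹) F := by
    refine HasProd.prod_fiberwise ((Equiv.prodComm ℕ Nat.Primes).hasProd_iff.2 hF) (fun l => ?_)
    have hl : 1 < (s + ((l : ℂ) + 1)).re := by
      have : (0 : ℝ) ≤ l := l.cast_nonneg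
      simp; linarith
    have := (riemannZeta_eulerProduct_hasProd hl).inv₀ (riemannZeta_ne_zero_of_one_lt_re hl)
    simpa [sub_eq_add_neg] using this
  have hB : HasProd (fun p : Nat.Primes => ∏' ℓ : ℕ, (1 - ((p : ℕ) : ℂ) ^ (-(s + (ℓ + 1))))) F := by
    refine HasProd.prod_fiberwise hF (fun p => ?_)
    have := Complex.multipliable_one_add_of_summable (hsum.prod_factor p)
    simpa only [sub_eq_add_neg] using this.hasProd
  have hT : (∑' m : ℕ+, a m / (m : ℂ) ^ s) = LSeries a s := by
    unfold LSeries
    rw [← tsum_pnat_eq_tsum_of_eq_zero (by simp)]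
    refine tsum_congr (fun m => ?_)
    rw [LSeries.term_of_ne_zero m.ne_zero]
  have hL : LSeries a s = F := by
    have h1 := hA.tendsto_prod_nat.mul (aux_tendsto a ha1 hfix s hs)
    rw [mul_one] at h1
    refine tendsto_nhds_unique ?_ h1
    exact tendsto_const_nhds.congr (fun N => aux_iter a ha1 hfix s hs N)
  refine ⟨hA.multipliable, ?_, ?_⟩
  · rw [hT, hL, hA.tprod_eq]
  · rw [hT, hL, hB.tprod_eq]
end

section
/- Let a : ℕ≥1 → ℂ satisfy a(1) = 1 and fix(a) = a, i.e. Σ_{d∣n} d·a(d) = a(n) for all n ≥ 1. Define b : ℕ≥1 → ℂ by b(1) = 1 and, for n = p₁^{r₁} ⋯ p_s^{r_s} > 1, b(n) = ∏_{j=1}^{s} p_j^{r_j(r_j−1)/2} / ∏_{ℓ=1}^{r_j} (p_j^{ℓ} − 1). Then b is the Dirichlet inverse of a: (a ∗ b)(n) = Σ_{d∣n} a(d)·b(n/d) equals 1 for n = 1 and 0 for n > 1. -/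
open Complex Finset

/-- Value of `b` at the prime power `p ^ r`. -/
noncomputable def betaPP (p r : ℕ) : ℂ :=
  ((p : ℂ) ^ (r * (r - 1) / 2)) / ∏ l ∈ Finset.Icc 1 r, ((p : ℂ) ^ l - 1)

lemma betaPP_zero (p : ℕ) : betaPP p 0 = 1 := by simp [betaPP]

lemma pow_sub_one_ne (p k : ℕ) (hp : p.Prime) : (p : ℂ) ^ (k + 1) - 1 ≠ 0 := by
  rw [sub_ne_zero]
  have h : p ^ (k + 1) ≠ 1 := (Nat.one_lt_pow (by omega) hp.one_lt).ne'
  exact_mod_cast h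

lemma betaPP_succ (p k : ℕ) (hp : p.Prime) :
    ((p : ℂ) ^ (k + 1) - 1) * betaPP p (k + 1) = (p : ℂ) ^ k * betaPP p k := by
  have h1 := pow_sub_one_ne p k hp
  have h2 : ∏ l ∈ Finset.Icc 1 k, ((p : ℂ) ^ l - 1) ≠ 0 := by
    rw [Finset.prod_ne_zero_iff]
    intro l hl
    obtain ⟨m, rfl⟩ : ∃ m, l = m + 1 := ⟨l - 1, by grind⟩
    exact pow_sub_one_ne p m hp
  have h3 : (k + 1) * (k + 1 - 1) / 2 = k + k * (k - 1) / 2 := by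
    have h := Nat.triangle_succ k
    omega
  unfold betaPP
  rw [Finset.prod_Icc_succ_top (by omega), h3, pow_add (p : ℂ) k (k * (k - 1) / 2)]
  generalize (p : ℂ) ^ (k + 1) - 1 = x at *
  field_simp

lemma betaPP_sum (p k : ℕ) (hp : p.Prime) :
    ∑ i ∈ Finset.range (k + 1), betaPP p i = (p : ℂ) ^ k * betaPP p k := by
  induction k with
  | zero => simp
  | succ k ih =>
    rw [Finset.sum_range_succ, ih, ← betaPP_succ p k hp]
    ring

/-- The function `b` as an arithmetic function. -/
noncomputable def bArith : ArithmeticFunction ℂ :=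
  ⟨fun n => if n = 0 then 0 else n.factorization.prod betaPP, by simp⟩

lemma bArith_apply {n : ℕ} (hn : n ≠ 0) : bArith n = n.factorization.prod betaPP := by
  simp [bArith, hn]

lemma bArith_mult : bArith.IsMultiplicative := by
  rw [ArithmeticFunction.IsMultiplicative.iff_ne_zero]
  refine ⟨by simp [bArith_apply], ?_⟩
  intro m n hm hn h
  rw [bArith_apply hm, bArith_apply hn, bArith_apply (mul_ne_zero hm hn),
    Nat.factorization_mul_of_coprime h,
    Finsupp.prod_add_index_of_disjoint (by simpa using h.disjoint_primeFactors)]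

lemma bArith_pp (p k : ℕ) (hp : p.Prime) : bArith (p ^ k) = betaPP p k := by
  rw [bArith_apply (pow_ne_zero _ hp.ne_zero), hp.factorization_pow,
    Finsupp.prod_single_index (betaPP_zero p)]

/-- Identity function. -/
noncomputable def idC : ArithmeticFunction ℂ := ((ArithmeticFunction.id : ArithmeticFunction ℕ) : ArithmeticFunction ℂ)

lemma bArith_zeta : bArith * (ArithmeticFunction.zeta : ArithmeticFunction ℂ) =
    idC.pmul bArith := by
  unfold idC
  rw [ArithmeticFunction.IsMultiplicative.eq_iff_eq_on_prime_powers _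
    (bArith_mult.mul ArithmeticFunction.isMultiplicative_zeta.natCast) _
    ((ArithmeticFunction.isMultiplicative_id.natCast).pmul bArith_mult)]
  intro p k hp
  rw [ArithmeticFunction.coe_mul_zeta_apply, Nat.sum_divisors_prime_pow hp]
  simp only [bArith_pp _ _ hp, ArithmeticFunction.pmul_apply]
  rw [betaPP_sum p k hp]
  simp

lemma idC_pmul_mul (f g : ArithmeticFunction ℂ) :
    idC.pmul (f * g) = idC.pmul f * idC.pmul g := by
  ext n
  simp only [ArithmeticFunction.pmul_apply, ArithmeticFunction.mul_apply, Finset.mul_sum]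
  refine Finset.sum_congr rfl fun x hx => ?_
  rw [← (Nat.mem_divisorsAntidiagonal.1 hx).1]
  simp only [idC, ArithmeticFunction.natCoe_apply, ArithmeticFunction.id_apply]
  push_cast
  ring

theorem stmt9 (a b : ℕ → ℂ) (ha1 : a 1 = 1)
    (hfix : ∀ n : ℕ, 1 ≤ n → ∑ d ∈ n.divisors, (d : ℂ) * a d = a n)
    (hb1 : b 1 = 1)
    (hb : ∀ n : ℕ, 1 < n →
      b n = ∏ p ∈ n.primeFactors,
        ((p : ℂ) ^ (n.factorization p * (n.factorization p - 1) / 2)) /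
          ∏ ℓ ∈ Finset.Icc 1 (n.factorization p), ((p : ℂ) ^ ℓ - 1)) :
    ∀ n : ℕ, 1 ≤ n →
      ∑ d ∈ n.divisors, a d * b (n / d) = if n = 1 then 1 else 0 := by
  have hbA : ∀ n : ℕ, 1 ≤ n → b n = bArith n := by
    intro n hn
    rcases hn.eq_or_lt with h | h
    · rw [← h, hb1, bArith_mult.1]
    · rw [hb n h, bArith_apply (by omega)]
      rfl
  let A : ArithmeticFunction ℂ := ⟨fun n => if n = 0 then 0 else a n, by simp⟩
  have hA : ∀ n : ℕ, n ≠ 0 → A n = a n := fun n hn => by simp [A, hn]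
  have hAfix : idC.pmul A * (ArithmeticFunction.zeta : ArithmeticFunction ℂ) = A := by
    ext n
    rcases Nat.eq_zero_or_pos n with rfl | hn
    · simp
    rw [ArithmeticFunction.coe_mul_zeta_apply, hA n hn.ne', ← hfix n hn]
    refine Finset.sum_congr rfl fun d hd => ?_
    rw [ArithmeticFunction.pmul_apply, hA d (Nat.pos_of_mem_divisors hd).ne']
    simp [idC]
  have hg : idC.pmul (A * bArith) = A * bArith := by
    rw [idC_pmul_mul, ← bArith_zeta, mul_comm bArith, ← mul_assoc, hAfix]
  intro n hn
  have hs : ∑ d ∈ n.divisors, a d * b (n / d) = (A * bArith) n := by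
    rw [ArithmeticFunction.mul_apply, Nat.sum_divisorsAntidiagonal (fun x y => A x * bArith y)]
    refine Finset.sum_congr rfl fun d hd => ?_
    rw [hA d (Nat.pos_of_mem_divisors hd).ne', hbA]
    exact Nat.div_pos (Nat.divisor_le hd) (Nat.pos_of_mem_divisors hd)
  split_ifs with h1
  · subst h1
    simp [ha1, hb1]
  · rw [hs]
    have h := congrArg (fun f : ArithmeticFunction ℂ => f n) hg
    simp only [ArithmeticFunction.pmul_apply] at h
    have hid : idC n = (n : ℂ) := by simp [idC]
    rw [hid] at h
    have h2 : ((n : ℂ) - 1) * (A * bArith) n = 0 := by rw [sub_mul, h]; ring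
    rcases mul_eq_zero.1 h2 with h3 | h3
    · exact absurd (by exact_mod_cast sub_eq_zero.1 h3) h1
    · exact h3
end

section
/- Let a : ℕ≥1 → ℂ satisfy a(1) = 1 and fix(a) = a, i.e. Σ_{d∣n} d·a(d) = a(n) for all n ≥ 1. For m ≥ 1 define a^{(m)} : ℕ≥1 → ℂ by a^{(m)}(n) = a(n/m) if m ∣ n and a^{(m)}(n) = 0 otherwise. Then a^{(m)} is an eigenvector of fix with eigenvalue m: fix(a^{(m)}) = m · a^{(m)}, i.e. Σ_{d∣n} d·a^{(m)}(d) = m·a^{(m)}(n) for all n ≥ 1. -/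
open Complex Finset

theorem stmt10 (a : ℕ → ℂ) (ha1 : a 1 = 1)
    (hfix : ∀ n : ℕ, 1 ≤ n → ∑ d ∈ n.divisors, (d : ℂ) * a d = a n)
    (m : ℕ) (hm : 1 ≤ m) :
    ∀ n : ℕ, 1 ≤ n →
      ∑ d ∈ n.divisors, (d : ℂ) * (if m ∣ d then a (d / m) else 0) =
        (m : ℂ) * (if m ∣ n then a (n / m) else 0) := by
  intro n hn
  by_cases h : m ∣ n
  · obtain ⟨k, rfl⟩ := h
    have hk : 1 ≤ k := by
      rcases Nat.eq_zero_or_pos k with h0 | h0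
      · subst h0
        simp at hn
      · exact h0
    rw [if_pos (Dvd.intro k rfl), Nat.mul_div_cancel_left k hm, ← hfix k hk, Finset.mul_sum]
    have hinj : Function.Injective (fun d : ℕ => m * d) :=
      fun x y hxy => Nat.eq_of_mul_eq_mul_left hm hxy
    rw [← Finset.sum_subset (s₁ := k.divisors.image (fun d => m * d)) (s₂ := (m * k).divisors)]
    · rw [Finset.sum_image (fun x _ y _ hxy => hinj hxy)]
      refine Finset.sum_congr rfl fun d _ => ?_
      rw [if_pos (Dvd.intro d rfl), Nat.mul_div_cancel_left d hm]
      push_cast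
      ring
    · intro x hx
      obtain ⟨d, hd, rfl⟩ := Finset.mem_image.mp hx
      exact Nat.mem_divisors.mpr
        ⟨Nat.mul_dvd_mul_left m (Nat.mem_divisors.mp hd).1, by omega⟩
    · intro x hx hx2
      rw [if_neg, mul_zero]
      rintro ⟨d, rfl⟩
      exact hx2 (Finset.mem_image.mpr ⟨d, Nat.mem_divisors.mpr
        ⟨Nat.dvd_of_mul_dvd_mul_left hm (Nat.mem_divisors.mp hx).1, by omega⟩, rfl⟩)
  · rw [if_neg h, mul_zero]
    refine Finset.sum_eq_zero fun d hd => ?_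
    rw [if_neg (fun hmd => h (hmd.trans (Nat.mem_divisors.mp hd).1)), mul_zero]
end

section
/- Let λ ∈ ℂ be such that λ is not a positive integer, and let x : ℕ≥1 → ℂ satisfy fix(x) = λ·x, i.e. Σ_{d∣n} d·x(d) = λ·x(n) for all n ≥ 1. Then x = 0. In other words, every eigenvalue of the operator fix on the space of arithmetic functions is a positive integer. -/
open Complex Finset

theorem stmt11 (lam : ℂ) (hlam : ∀ N : ℕ, 1 ≤ N → lam ≠ (N : ℂ))
    (x : ℕ → ℂ)
    (hx : ∀ n : ℕ, 1 ≤ n → ∑ d ∈ n.divisors, (d : ℂ) * x d = lam * x n) :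
    ∀ n : ℕ, 1 ≤ n → x n = 0 := by
  intro n
  induction n using Nat.strong_induction_on with
  | _ n ih =>
    intro hn
    have h := hx n hn
    have h2 : ∑ d ∈ n.divisors, (d : ℂ) * x d = (n : ℂ) * x n := by
      apply Finset.sum_eq_single_of_mem n (by simp; omega)
      intro d hd hne
      have hd1 : 1 ≤ d := Nat.pos_of_mem_divisors hd
      have hd2 : d ≤ n := Nat.divisor_le hd
      rw [ih d (by omega) hd1, mul_zero]
    rw [h2] at h
    by_contra h0
    exact hlam n hn (mul_right_cancel₀ h0 h).symm
end

section
/- For λ ∈ ℂ, the linear map f ↦ fix(f) − λ·f on the space of arithmetic functions ℕ≥1 → ℂ is bijective if and only if λ is not a positive integer. Consequently, the (algebraic) spectrum of fix, i.e. the set of λ ∈ ℂ for which fix − λ·id is not invertible, equals the set of positive integers ℕ. -/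
open Complex Finset

/-- The `fix` operator on the space of arithmetic functions `ℕ≥1 → ℂ`:
`fix(f)(n) = ∑_{d ∣ n} d · f(d)`. -/
noncomputable def fixP (f : ℕ+ → ℂ) : ℕ+ → ℂ := fun n =>
  ∑ d ∈ (n : ℕ).divisors.attach, (d.1 : ℂ) * f ⟨d.1, Nat.pos_of_mem_divisors d.2⟩

noncomputable def solP (lam c : ℂ) (g : ℕ → ℂ) (n : ℕ) : ℂ :=
  if (n : ℂ) = lam then c else
    (g n - ∑ d ∈ n.properDivisors.attach, (d.1 : ℂ) * solP lam c g d.1) / ((n : ℂ) - lam)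
termination_by n
decreasing_by exact (Nat.mem_properDivisors.mp d.2).2

lemma solP_eq (lam c : ℂ) (g : ℕ → ℂ) (n : ℕ) : solP lam c g n =
    if (n : ℂ) = lam then c else
    (g n - ∑ d ∈ n.properDivisors, (d : ℂ) * solP lam c g d) / ((n : ℂ) - lam) := by
  rw [solP, Finset.sum_attach n.properDivisors (fun d => (d : ℂ) * solP lam c g d)]

lemma fixP_nat (F : ℕ → ℂ) (n : ℕ+) : fixP (fun m => F m) n =
    (∑ d ∈ (n : ℕ).properDivisors, (d : ℂ) * F d) + (n : ℂ) * F n := by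
  have h := Finset.sum_attach (n : ℕ).divisors (fun d => (d : ℂ) * F d)
  have h2 : ∑ d ∈ (n : ℕ).divisors, (d : ℂ) * F d =
      (∑ d ∈ (n : ℕ).properDivisors, (d : ℂ) * F d) + (n : ℂ) * F n := by
    rw [← Nat.insert_self_properDivisors n.ne_zero,
      Finset.sum_insert Nat.self_notMem_properDivisors, add_comm]
  rw [← h2, ← h]
  rfl

lemma fixP_zero (n : ℕ+) : fixP (fun _ => 0) n = 0 := by
  simp [fixP]

lemma exists_ext (f : ℕ+ → ℂ) : ∃ F : ℕ → ℂ, f = fun m : ℕ+ => F m :=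
  ⟨fun m => f m.toPNat', by
    funext m
    simp⟩

lemma bij_of (lam : ℂ) (h : ∀ N : ℕ+, lam ≠ (N : ℂ)) :
    Function.Bijective (fun f : ℕ+ → ℂ => fun n => fixP f n - lam * f n) := by
  constructor
  · intro f₁ f₂ he
    obtain ⟨F, rfl⟩ := exists_ext f₁
    obtain ⟨G, rfl⟩ := exists_ext f₂
    have key : ∀ n : ℕ, 0 < n → F n = G n := by
      intro n
      induction n using Nat.strong_induction_on with
      | _ n ih =>
        intro hn
        have e0 := congrFun he ⟨n, hn⟩
        have e1 := fixP_nat F ⟨n, hn⟩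
        have e2 := fixP_nat G ⟨n, hn⟩
        have e : (∑ d ∈ n.properDivisors, (d : ℂ) * F d) + (n : ℂ) * F n - lam * F n =
            (∑ d ∈ n.properDivisors, (d : ℂ) * G d) + (n : ℂ) * G n - lam * G n := by
          change fixP _ _ - lam * F n = fixP _ _ - lam * G n at e0
          rw [e1, e2] at e0
          exact e0
        have hs : ∑ d ∈ n.properDivisors, (d : ℂ) * F d
            = ∑ d ∈ n.properDivisors, (d : ℂ) * G d :=
          Finset.sum_congr rfl fun d hd => by
            rw [ih d (Nat.mem_properDivisors.mp hd).2 (Nat.pos_of_mem_properDivisors hd)]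
        rw [hs] at e
        have hne : (n : ℂ) - lam ≠ 0 := sub_ne_zero.mpr (h ⟨n, hn⟩).symm
        apply mul_left_cancel₀ hne
        linear_combination e
    funext m
    exact key m m.pos
  · intro g
    obtain ⟨G, rfl⟩ := exists_ext g
    refine ⟨fun m => solP lam 0 G m, ?_⟩
    funext n
    have hne : (n : ℂ) - lam ≠ 0 := sub_ne_zero.mpr (h n).symm
    have e := solP_eq lam 0 G n
    rw [if_neg (h n).symm, eq_div_iff hne] at e
    simp only [fixP_nat]
    linear_combination e

lemma not_bij (N : ℕ+) :
    ¬ Function.Bijective (fun f : ℕ+ → ℂ => fun n => fixP f n - (N : ℂ) * f n) := by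
  intro hb
  set F := solP (N : ℂ) 1 (fun _ => 0) with hF
  have small : ∀ n : ℕ, n < N → F n = 0 := by
    intro n
    induction n using Nat.strong_induction_on with
    | _ n ih =>
      intro hn
      rw [hF, solP_eq, if_neg (by exact_mod_cast hn.ne), Finset.sum_eq_zero]
      · simp
      · intro d hd
        have hd' := (Nat.mem_properDivisors.mp hd).2
        rw [← hF, ih d hd' (hd'.trans hn), mul_zero]
  have hN : F N = 1 := by rw [hF, solP_eq, if_pos rfl]
  have hz : (fun m : ℕ+ => F m) = fun m : ℕ+ => (fun _ : ℕ => (0 : ℂ)) m := by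
    apply hb.1
    funext n
    simp only [fixP_nat, fixP_zero]
    by_cases hn : (n : ℂ) = N
    · have hn' : n = N := by exact_mod_cast hn
      subst hn'
      rw [Finset.sum_eq_zero]
      · simp
      · intro d hd
        rw [small d (Nat.mem_properDivisors.mp hd).2, mul_zero]
    · have e := solP_eq (N : ℂ) 1 (fun _ => 0) n
      rw [if_neg hn, eq_div_iff (sub_ne_zero.mpr hn), ← hF] at e
      simp only [mul_zero]
      linear_combination e
  have := congrFun hz N
  simp [hN] at this

theorem stmt13 :
    (∀ lam : ℂ,
      Function.Bijective (fun f : ℕ+ → ℂ => fun n => fixP f n - lam * f n) ↔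
        ∀ N : ℕ+, lam ≠ (N : ℂ)) ∧
    {lam : ℂ |
        ¬ Function.Bijective (fun f : ℕ+ → ℂ => fun n => fixP f n - lam * f n)} =
      Set.range (fun N : ℕ+ => (N : ℂ)) := by
  have key : ∀ lam : ℂ,
      Function.Bijective (fun f : ℕ+ → ℂ => fun n => fixP f n - lam * f n) ↔
        ∀ N : ℕ+, lam ≠ (N : ℂ) := by
    intro lam
    refine ⟨?_, bij_of lam⟩
    rintro hb N rfl
    exact not_bij N hb
  refine ⟨key, ?_⟩
  ext lam
  rw [Set.mem_ofPred_eq, key lam]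
  simp [eq_comm]
end

section
/- For λ ∈ ℂ, the linear map f ↦ orb(f) − λ·f on the space of arithmetic functions ℕ≥1 → ℂ is bijective if and only if λ is not of the form 1/N for a positive integer N. Consequently, the (algebraic) spectrum of orb equals {1/N : N ∈ ℕ, N ≥ 1}. -/
open Complex Finset

/-- The `orb` operator on the space of arithmetic functions `ℕ≥1 → ℂ`:
`orb(f)(n) = (1/n) · ∑_{d ∣ n} μ(n/d) · f(d)`. -/
noncomputable def orbP (f : ℕ+ → ℂ) : ℕ+ → ℂ := fun n =>
  (1 / ((n : ℕ) : ℂ)) * ∑ d ∈ (n : ℕ).divisors.attach,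
    ((ArithmeticFunction.moebius ((n : ℕ) / d.1) : ℤ) : ℂ) *
      f ⟨d.1, Nat.pos_of_mem_divisors d.2⟩

lemma orbP_local (f g : ℕ+ → ℂ) (n : ℕ+) (h : ∀ m < n, f m = g m) :
    orbP f n - orbP g n = ((n : ℂ))⁻¹ * (f n - g n) := by
  unfold orbP
  rw [← mul_sub, ← Finset.sum_sub_distrib, one_div]
  congr 1
  have hn : (n : ℕ) ∈ (n : ℕ).divisors := Nat.mem_divisors_self _ n.ne_zero
  rw [Finset.sum_eq_single (⟨(n : ℕ), hn⟩ : {x // x ∈ (n : ℕ).divisors})]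
  · have e : (⟨(n : ℕ), Nat.pos_of_mem_divisors hn⟩ : ℕ+) = n := rfl
    simp [Nat.div_self n.pos, e]
  · intro b _ hb
    have hlt : (⟨b.1, Nat.pos_of_mem_divisors b.2⟩ : ℕ+) < n := by
      have h1 : b.1 ≤ (n : ℕ) := Nat.divisor_le b.2
      have h2 : b.1 ≠ (n : ℕ) := fun h => hb (Subtype.ext h)
      exact PNat.coe_lt_coe _ _ |>.1 (lt_of_le_of_ne h1 h2)
    rw [h _ hlt, sub_self]
  · intro hh
    exact absurd (Finset.mem_attach _ _) hh

lemma orb_determined (lam : ℂ) (f g : ℕ+ → ℂ) (n : ℕ+)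
    (hl : ∀ m ≤ n, lam ≠ ((m : ℂ))⁻¹)
    (h : ∀ m ≤ n, orbP f m - lam * f m = orbP g m - lam * g m) : f n = g n := by
  induction n using PNat.strongInductionOn with
  | _ n ih =>
    have hlow : ∀ m < n, f m = g m := fun m hm =>
      ih m hm (fun k hk => hl k (hk.trans hm.le)) (fun k hk => h k (hk.trans hm.le))
    have h1 := orbP_local f g n hlow
    have h2 := h n le_rfl
    have h3 : (((n : ℂ))⁻¹ - lam) * (f n - g n) = 0 := by linear_combination h2 - h1
    rcases mul_eq_zero.1 h3 with h4 | h4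
    · exact absurd (sub_eq_zero.1 h4).symm (hl n le_rfl)
    · exact sub_eq_zero.1 h4

/-- Recursive solution of `orb f - lam f = g`. -/
noncomputable def orbSol (lam : ℂ) (g : ℕ+ → ℂ) : ℕ+ → ℂ :=
  (wellFounded_lt : WellFounded ((· < ·) : ℕ+ → ℕ+ → Prop)).fix fun n ih =>
    (g n - orbP (fun m => if h : m < n then ih m h else 0) n) / (((n : ℂ))⁻¹ - lam)

lemma orbSol_spec (lam : ℂ) (hl : ∀ N : ℕ+, lam ≠ ((N : ℂ))⁻¹) (g : ℕ+ → ℂ) (n : ℕ+) :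
    orbP (orbSol lam g) n - lam * orbSol lam g n = g n := by
  have e : orbSol lam g n = (g n - orbP (fun m => if m < n then orbSol lam g m else 0) n)
      / (((n : ℂ))⁻¹ - lam) := by
    conv_lhs => rw [orbSol, WellFounded.fix_eq]
    simp only [dite_eq_ite]
    rfl
  have h1 := orbP_local (orbSol lam g) (fun m => if m < n then orbSol lam g m else 0) n
    (fun m hm => by simp [hm])
  have h0 : ((n : ℂ))⁻¹ - lam ≠ 0 := sub_ne_zero.2 (hl n).symm
  rw [eq_div_iff h0] at e
  simp only [lt_irrefl, if_false, sub_zero] at h1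
  linear_combination h1 + e

lemma orb_bij_iff (lam : ℂ) :
    Function.Bijective (fun f : ℕ+ → ℂ => fun n => orbP f n - lam * f n) ↔
      ∀ N : ℕ+, lam ≠ ((N : ℂ))⁻¹ := by
  constructor
  · rintro ⟨-, hs⟩ N rfl
    obtain ⟨f, hf⟩ := hs (fun n => if n = N then 1 else 0)
    have hf' : ∀ n, orbP f n - ((N : ℂ))⁻¹ * f n = if n = N then 1 else 0 :=
      fun n => congrFun hf n
    have z : ∀ n, orbP (fun _ => 0) n = 0 := fun n => by simp [orbP]
    have hlow : ∀ m < N, f m = (fun _ : ℕ+ => (0 : ℂ)) m := by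
      intro m hm
      apply orb_determined ((N : ℂ))⁻¹ f (fun _ => 0) m
      · intro k hk hkN
        have : N = k := by
          have := inv_injective hkN
          exact_mod_cast this
        exact absurd (this ▸ hk) (not_le.2 hm)
      · intro k hk
        rw [hf', z, if_neg (hk.trans_lt hm).ne]
        simp
    have h1 := orbP_local f (fun _ => 0) N hlow
    have h2 := hf' N
    rw [if_pos rfl] at h2
    rw [z] at h1
    have : (1 : ℂ) = 0 := by linear_combination h1 - h2
    exact one_ne_zero this
  · intro hl
    refine ⟨fun f g h => ?_, fun g => ⟨orbSol lam g, funext (orbSol_spec lam hl g)⟩⟩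
    funext n
    exact orb_determined lam f g n (fun m _ => hl m) (fun m _ => congrFun h m)



theorem stmt14 :
    (∀ lam : ℂ,
      Function.Bijective (fun f : ℕ+ → ℂ => fun n => orbP f n - lam * f n) ↔
        ∀ N : ℕ+, lam ≠ ((N : ℂ))⁻¹) ∧
    {lam : ℂ |
        ¬ Function.Bijective (fun f : ℕ+ → ℂ => fun n => orbP f n - lam * f n)} =
      Set.range (fun N : ℕ+ => ((N : ℂ))⁻¹) := by
  refine ⟨orb_bij_iff, ?_⟩
  ext lam
  simp only [Set.mem_ofPred_eq, Set.mem_range, orb_bij_iff, not_forall, not_not]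
  exact ⟨fun ⟨N, h⟩ => ⟨N, h.symm⟩, fun ⟨N, h⟩ => ⟨N, h.symm⟩⟩
end

section
/- Let δ₁ : ℕ≥1 → ℂ be the arithmetic function with δ₁(1) = 1 and δ₁(n) = 0 for n > 1, and let y^{(n)} = fix^n(δ₁) denote the n-th iterate of fix applied to δ₁. Then for every prime p and all integers r, n ≥ 1, y^{(n)}(p^r) = ∏_{i=0}^{r-1} (1 − p^{n+r-1-i})/(1 − p^{i+1}), the Gaussian (p-)binomial coefficient [n+r−1 choose r]_p. -/
open Complex Finset

/-- The `fix` operator on arithmetic functions: `fix(f)(n) = ∑_{d ∣ n} d · f(d)`. -/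
noncomputable def fixOp (f : ℕ → ℂ) : ℕ → ℂ := fun n => ∑ d ∈ n.divisors, (d : ℂ) * f d

/-- The arithmetic function `δ₁ = (1, 0, 0, …)`. -/
noncomputable def delta1 : ℕ → ℂ := fun n => if n = 1 then 1 else 0

/-- The q-binomial coefficient, as quotient of products. -/
noncomputable def gaussAux (q : ℂ) (n r : ℕ) : ℂ :=
  (∏ i ∈ Finset.range r, (1 - q ^ (n + i))) / ∏ i ∈ Finset.range r, (1 - q ^ (i + 1))

lemma gaussAux_succ (q : ℂ) (hq : ∀ k : ℕ, 1 - q ^ (k + 1) ≠ 0) (n r : ℕ) :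
    gaussAux q (n + 1) (r + 1) = gaussAux q (n + 1) r + q ^ (r + 1) * gaussAux q n (r + 1) := by
  unfold gaussAux
  have hD : ∏ i ∈ Finset.range r, (1 - q ^ (i + 1)) ≠ 0 :=
    Finset.prod_ne_zero_iff.mpr fun i _ => hq i
  have h1 : ∏ i ∈ Finset.range (r + 1), (1 - q ^ (n + i))
      = (∏ i ∈ Finset.range r, (1 - q ^ (n + 1 + i))) * (1 - q ^ n) := by
    rw [Finset.prod_range_succ']
    congr 1
    exact Finset.prod_congr rfl fun i _ => by rw [show n + (i + 1) = n + 1 + i by ring]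
  rw [h1, Finset.prod_range_succ, Finset.prod_range_succ]
  have := hq r
  field_simp
  ring

lemma gaussAux_sum (q : ℂ) (hq : ∀ k : ℕ, 1 - q ^ (k + 1) ≠ 0) (n r : ℕ) :
    ∑ j ∈ Finset.range (r + 1), q ^ j * gaussAux q n j = gaussAux q (n + 1) r := by
  induction r with
  | zero => simp [gaussAux]
  | succ r ih => rw [Finset.sum_range_succ, ih, gaussAux_succ q hq]

lemma fixOp_iter (p : ℕ) (hp : p.Prime) (n : ℕ) :
    ∀ r : ℕ, (fixOp^[n] delta1) (p ^ r) = gaussAux (p : ℂ) n r := by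
  have hq : ∀ k : ℕ, 1 - (p : ℂ) ^ (k + 1) ≠ 0 := by
    intro k h
    have h2 : ((p ^ (k + 1) : ℕ) : ℂ) = ((1 : ℕ) : ℂ) := by
      push_cast
      exact (sub_eq_zero.mp h).symm
    have h3 : p ^ (k + 1) = 1 := Nat.cast_injective h2
    have h4 : 1 < p ^ (k + 1) := Nat.one_lt_pow (Nat.succ_ne_zero k) hp.one_lt
    omega
  induction n with
  | zero =>
    intro r
    cases r with
    | zero => simp [gaussAux, delta1]
    | succ r =>
      have h4 : 1 < p ^ (r + 1) := Nat.one_lt_pow (Nat.succ_ne_zero r) hp.one_lt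
      have h5 : p ^ (r + 1) ≠ 1 := by omega
      rw [Function.iterate_zero, id, delta1, if_neg h5, gaussAux, Finset.prod_range_succ']
      simp
  | succ n ih =>
    intro r
    rw [Function.iterate_succ_apply', fixOp, Nat.sum_divisors_prime_pow hp, ← gaussAux_sum _ hq]
    exact Finset.sum_congr rfl fun j _ => by rw [ih]; push_cast; rfl

theorem stmt15 (p : ℕ) (hp : p.Prime) (r n : ℕ) (hr : 1 ≤ r) (hn : 1 ≤ n) :
    (fixOp^[n] delta1) (p ^ r) =
      ∏ i ∈ Finset.range r,
        (1 - (p : ℂ) ^ (n + r - 1 - i)) / (1 - (p : ℂ) ^ (i + 1)) := by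
  rw [fixOp_iter p hp, gaussAux, Finset.prod_div_distrib]
  congr 1
  rw [← Finset.prod_range_reflect]
  refine Finset.prod_congr rfl fun i hi => ?_
  have := Finset.mem_range.mp hi
  rw [show n + (r - 1 - i) = n + r - 1 - i by omega]
end

section
/- Let δ₁ : ℕ≥1 → ℂ be the arithmetic function with δ₁(1) = 1 and δ₁(n) = 0 for n > 1, and let y^{(n)} = fix^n(δ₁). Then for every n ≥ 1 and every m > 1 with prime factorization m = p₁^{r₁} ⋯ p_k^{r_k}, one has y^{(n)}(m) = ∏_{j=1}^{k} y^{(n)}(p_j^{r_j}) = ∏_{j=1}^{k} ∏_{i=0}^{r_j−1} (1 − p_j^{n+r_j−1−i})/(1 − p_j^{i+1}). -/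
open Complex Finset

theorem fixOp_mult (f : ℕ → ℂ) (h1 : f 1 = 1)
    (hf : ∀ a b, Nat.Coprime a b → f (a * b) = f a * f b) :
    fixOp f 1 = 1 ∧ ∀ a b, Nat.Coprime a b → fixOp f (a * b) = fixOp f a * fixOp f b := by
  refine ⟨by simp [fixOp, h1], ?_⟩
  intro a b hab
  let F : ArithmeticFunction ℂ := ⟨fun n => (n : ℂ) * f n, by simp⟩
  have hF : F.IsMultiplicative := by
    refine ⟨by simp [F, h1], ?_⟩
    intro a b hab
    simp only [F, ArithmeticFunction.coe_mk, hf a b hab, Nat.cast_mul]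
    ring
  have hz : ∀ n, fixOp f n = ((ArithmeticFunction.zeta : ArithmeticFunction ℂ) * F) n := by
    intro n
    rw [ArithmeticFunction.coe_zeta_mul_apply]
    rfl
  rw [hz, hz, hz]
  exact (ArithmeticFunction.isMultiplicative_zeta.natCast.mul hF).map_mul_of_coprime hab

theorem iter_mult (n : ℕ) : (fixOp^[n] delta1) 1 = 1 ∧
    ∀ a b, Nat.Coprime a b → (fixOp^[n] delta1) (a * b) =
      (fixOp^[n] delta1) a * (fixOp^[n] delta1) b := by
  induction n with
  | zero =>
    refine ⟨by simp [delta1], ?_⟩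
    intro a b _
    simp only [Function.iterate_zero, id, delta1, mul_eq_one]
    by_cases ha : a = 1 <;> by_cases hb : b = 1 <;> simp [ha, hb]
  | succ n ih =>
    rw [Function.iterate_succ_apply']
    exact fixOp_mult _ ih.1 ih.2

/-- The reflected product. -/
noncomputable def hProd (q : ℂ) (n r : ℕ) : ℂ :=
  ∏ i ∈ Finset.range r, (1 - q ^ (n + i)) / (1 - q ^ (i + 1))

theorem hProd_eq (q : ℂ) (n r : ℕ) :
    ∏ i ∈ Finset.range r, (1 - q ^ (n + r - 1 - i)) / (1 - q ^ (i + 1)) = hProd q n r := by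
  unfold hProd
  rw [Finset.prod_div_distrib, Finset.prod_div_distrib]
  congr 1
  rw [← Finset.prod_range_reflect]
  refine Finset.prod_congr rfl fun i hi => ?_
  have := Finset.mem_range.1 hi
  congr 2
  omega

theorem hProd_shift (q : ℂ) (n r : ℕ) (hq : ∀ i : ℕ, 1 - q ^ (i + 1) ≠ 0) :
    hProd q n (r + 1) = hProd q (n + 1) r * ((1 - q ^ n) / (1 - q ^ (r + 1))) := by
  unfold hProd
  rw [Finset.prod_div_distrib, Finset.prod_div_distrib, Finset.prod_range_succ',
    Finset.prod_range_succ (fun i => 1 - q ^ (i + 1))]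
  rw [div_mul_div_comm]
  simp only [add_zero]
  congr 2
  refine Finset.prod_congr rfl fun i _ => ?_
  congr 2
  omega

theorem hProd_rec (q : ℂ) (n r : ℕ) (hq : ∀ i : ℕ, 1 - q ^ (i + 1) ≠ 0) :
    hProd q (n + 1) (r + 1) = hProd q (n + 1) r + q ^ (r + 1) * hProd q n (r + 1) := by
  rw [hProd_shift q n r hq]
  have h := hq r
  have : hProd q (n + 1) (r + 1) =
      hProd q (n + 1) r * ((1 - q ^ (n + 1 + r)) / (1 - q ^ (r + 1))) := by
    unfold hProd
    rw [Finset.prod_range_succ]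
  rw [this]
  field_simp
  ring

theorem iter_pow (p : ℕ) (hp : p.Prime) (n : ℕ) :
    ∀ r, (fixOp^[n] delta1) (p ^ r) = hProd p n r := by
  have hq : ∀ i : ℕ, 1 - (p : ℂ) ^ (i + 1) ≠ 0 := by
    intro i h
    have h2 : ((p ^ (i + 1) : ℕ) : ℂ) = ((1 : ℕ) : ℂ) := by
      push_cast
      linear_combination -h
    have h3 := Nat.cast_injective h2
    exact absurd h3 (Nat.one_lt_pow (by omega) hp.one_lt).ne'
  induction n with
  | zero =>
    intro r
    cases r with
    | zero => simp [delta1, hProd]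
    | succ r =>
      have := (Nat.one_lt_pow (Nat.succ_ne_zero r) hp.one_lt).ne'
      simp only [Function.iterate_zero, id, delta1, hProd]
      rw [if_neg this, Finset.prod_range_succ']
      simp
  | succ n ih =>
    intro r
    rw [Function.iterate_succ_apply']
    have key : ∀ r, fixOp (fixOp^[n] delta1) (p ^ r) =
        ∑ j ∈ Finset.range (r + 1), (p : ℂ) ^ j * hProd p n j := by
      intro r
      change ∑ d ∈ (p ^ r).divisors, (d : ℂ) * (fixOp^[n] delta1) d = _
      rw [Nat.sum_divisors_prime_pow hp]
      refine Finset.sum_congr rfl fun j _ => ?_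
      rw [← ih j]
      simp
    rw [key]
    induction r with
    | zero => simp [hProd]
    | succ r ihr => rw [Finset.sum_range_succ, ihr, hProd_rec _ _ _ hq]

theorem stmt16 (n m : ℕ) (hn : 1 ≤ n) (hm : 1 < m) :
    (fixOp^[n] delta1) m =
      (∏ p ∈ m.primeFactors, (fixOp^[n] delta1) (p ^ m.factorization p)) ∧
    (fixOp^[n] delta1) m =
      ∏ p ∈ m.primeFactors, ∏ i ∈ Finset.range (m.factorization p),
        (1 - (p : ℂ) ^ (n + m.factorization p - 1 - i)) / (1 - (p : ℂ) ^ (i + 1)) := by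
  have h : (fixOp^[n] delta1) m =
      (∏ p ∈ m.primeFactors, (fixOp^[n] delta1) (p ^ m.factorization p)) := by
    rw [Nat.multiplicative_factorization _ (fun a b h => (iter_mult n).2 a b h)
      (iter_mult n).1 (by omega : m ≠ 0)]
    rfl
  refine ⟨h, h.trans (Finset.prod_congr rfl fun p hp => ?_)⟩
  rw [hProd_eq, iter_pow p (Nat.prime_of_mem_primeFactors hp)]
end

section
/- Let δ₁ : ℕ≥1 → ℂ be the arithmetic function with δ₁(1) = 1 and δ₁(n) = 0 for n > 1, and let y^{(n)} = fix^n(δ₁). Then for all n, m ≥ 1, y^{(n)}(m) equals the number of sublattices (i.e. additive subgroups) of ℤ^n of index m: y^{(n)}(m) = #{Λ ⊆ ℤ^n : Λ is a subgroup of index m}. -/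
open Complex Finset

theorem index_prod_formula {A : Type*} [AddCommGroup A] (Λ : AddSubgroup (A × ℤ)) :
    Λ.index = (Λ.comap (AddMonoidHom.inl A ℤ)).index * (Λ.map (AddMonoidHom.snd A ℤ)).index := by
  have h1 : (Λ.map (AddMonoidHom.snd A ℤ)).comap (AddMonoidHom.snd A ℤ)
      = Λ ⊔ (AddMonoidHom.inl A ℤ).range := by
    rw [AddSubgroup.comap_map_eq]
    congr 1
    ext ⟨a, t⟩
    rw [AddMonoidHom.mem_ker, AddMonoidHom.mem_range]
    simp [eq_comm]
  have h2 : (Λ.map (AddMonoidHom.snd A ℤ)).index = (Λ ⊔ (AddMonoidHom.inl A ℤ).range).index := by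
    rw [← h1, AddSubgroup.index_comap_of_surjective _ Prod.snd_surjective]
  rw [h2, AddSubgroup.index_comap, ← AddSubgroup.relIndex_sup_right, sup_comm _ Λ,
    AddSubgroup.relIndex_mul_index le_sup_left]

/-- The sublattice of `A × ℤ` attached to `L`, `k` and a class `q`. -/
def glue {A : Type*} [AddCommGroup A] (L : AddSubgroup A) (k : ℤ) (q : A ⧸ L) :
    AddSubgroup (A × ℤ) where
  carrier := {p | ∃ j : ℤ, p.2 = j * k ∧ (p.1 : A ⧸ L) = j • q}
  zero_mem' := ⟨0, by simp⟩
  add_mem' := by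
    rintro ⟨a, s⟩ ⟨b, t⟩ ⟨i, hi, hi'⟩ ⟨j, hj, hj'⟩
    refine ⟨i + j, ?_, ?_⟩
    · simp only [Prod.snd_add] at *; rw [hi, hj]; ring
    · simp only [Prod.fst_add, QuotientAddGroup.mk_add] at *; rw [hi', hj', add_smul]
  neg_mem' := by
    rintro ⟨a, s⟩ ⟨i, hi, hi'⟩
    refine ⟨-i, ?_, ?_⟩
    · simp only [Prod.snd_neg] at *; rw [hi]; ring
    · simp only [Prod.fst_neg, QuotientAddGroup.mk_neg] at *; rw [hi', neg_smul]

theorem mem_glue {A : Type*} [AddCommGroup A] (L : AddSubgroup A) (k : ℤ) (q : A ⧸ L)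
    (a : A) (t : ℤ) : (a, t) ∈ glue L k q ↔ ∃ j : ℤ, t = j * k ∧ (a : A ⧸ L) = j • q := Iff.rfl

theorem glue_comap {A : Type*} [AddCommGroup A] (L : AddSubgroup A) (k : ℤ) (hk : k ≠ 0)
    (q : A ⧸ L) : (glue L k q).comap (AddMonoidHom.inl A ℤ) = L := by
  ext a
  rw [AddSubgroup.mem_comap, AddMonoidHom.inl_apply, mem_glue]
  constructor
  · rintro ⟨j, hj, h⟩
    have : j = 0 := by
      rcases mul_eq_zero.1 hj.symm with h | h
      · exact h
      · exact absurd h hk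
    subst this
    rw [zero_smul] at h
    exact (QuotientAddGroup.eq_zero_iff a).1 h
  · intro h
    exact ⟨0, by simp, by rw [zero_smul]; exact (QuotientAddGroup.eq_zero_iff a).2 h⟩

theorem glue_map {A : Type*} [AddCommGroup A] (L : AddSubgroup A) (k : ℤ)
    (q : A ⧸ L) : (glue L k q).map (AddMonoidHom.snd A ℤ) = AddSubgroup.zmultiples k := by
  ext t
  rw [AddSubgroup.mem_map, AddSubgroup.mem_zmultiples_iff]
  constructor
  · rintro ⟨⟨a, s⟩, ⟨j, hj, -⟩, rfl⟩
    exact ⟨j, by simpa using hj.symm⟩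
  · rintro ⟨j, rfl⟩
    obtain ⟨a, ha⟩ := QuotientAddGroup.mk_surjective (j • q)
    exact ⟨(a, j • k), ⟨j, by simp, ha⟩, rfl⟩

theorem glue_inj {A : Type*} [AddCommGroup A] (L : AddSubgroup A) (k : ℤ) (hk : k ≠ 0)
    (q r : A ⧸ L) (h : glue L k q = glue L k r) : q = r := by
  obtain ⟨a, rfl⟩ := QuotientAddGroup.mk_surjective q
  have h1 : (a, k) ∈ glue L k (a : A ⧸ L) := ⟨1, by simp, by simp⟩
  rw [h] at h1
  obtain ⟨j, hj, hj'⟩ := h1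
  have : j = 1 := by
    have : (j - 1) * k = 0 := by simp only at hj; linarith
    rcases mul_eq_zero.1 this with h | h
    · omega
    · exact absurd h hk
  subst this
  simpa using hj'

theorem glue_surj {A : Type*} [AddCommGroup A] (Λ : AddSubgroup (A × ℤ)) (k : ℤ)
    (hk : Λ.map (AddMonoidHom.snd A ℤ) = AddSubgroup.zmultiples k) :
    ∃ q, glue (Λ.comap (AddMonoidHom.inl A ℤ)) k q = Λ := by
  have : k ∈ Λ.map (AddMonoidHom.snd A ℤ) := by
    rw [hk]; exact AddSubgroup.mem_zmultiples k
  obtain ⟨⟨x, k'⟩, hx, rfl⟩ := this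
  simp only [AddMonoidHom.coe_snd] at *
  have key : ∀ (a : A) (j : ℤ), (a, j * k') ∈ Λ ↔
      (a : A ⧸ Λ.comap (AddMonoidHom.inl A ℤ)) = j • (x : A ⧸ Λ.comap (AddMonoidHom.inl A ℤ)) := by
    intro a j
    rw [← QuotientAddGroup.mk_zsmul, eq_comm, QuotientAddGroup.eq, AddSubgroup.mem_comap,
      ← AddSubgroup.add_mem_cancel_left Λ (Λ.neg_mem (Λ.zsmul_mem hx j))]
    simp
  refine ⟨(x : A ⧸ _), ?_⟩
  ext ⟨a, t⟩
  rw [mem_glue]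
  constructor
  · rintro ⟨j, rfl, h⟩
    exact (key a j).2 h
  · intro h
    have : t ∈ Λ.map (AddMonoidHom.snd A ℤ) := ⟨(a, t), h, rfl⟩
    rw [hk, AddSubgroup.mem_zmultiples_iff] at this
    obtain ⟨j, rfl⟩ := this
    rw [smul_eq_mul] at h ⊢
    exact ⟨j, rfl, (key a j).1 h⟩

theorem index_zmult (k : ℕ) : (AddSubgroup.zmultiples (k : ℤ)).index = k := by
  simp [Int.index_zmultiples]

/-- The parametrisation of sublattices. -/
def glueMap {A : Type*} [AddCommGroup A] (m : ℕ) (hm : 1 ≤ m) :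
    (Σ d : m.divisors, Σ L : {L : AddSubgroup A // L.index = d.1}, A ⧸ L.1) →
      {Λ : AddSubgroup (A × ℤ) // Λ.index = m} := fun p =>
  ⟨glue p.2.1.1 ((m / p.1.1 : ℕ) : ℤ) p.2.2, by
    obtain ⟨⟨d, hd⟩, ⟨L, hL⟩, q⟩ := p
    have hdm := Nat.dvd_of_mem_divisors hd
    have : m / d ≠ 0 := (Nat.div_pos (Nat.le_of_dvd hm hdm) (Nat.pos_of_mem_divisors hd)).ne'
    rw [index_prod_formula, glue_comap _ _ (by exact_mod_cast this), glue_map, index_zmult]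
    simp only at hL ⊢
    rw [hL, Nat.mul_div_cancel' hdm]⟩

theorem glueMap_bij {A : Type*} [AddCommGroup A] (m : ℕ) (hm : 1 ≤ m) :
    Function.Bijective (glueMap (A := A) m hm) := by
  constructor
  · rintro ⟨⟨d, hd⟩, ⟨L, hL⟩, q⟩ ⟨⟨e, he⟩, ⟨M, hM⟩, r⟩ h
    simp only at hL hM q r
    subst hL hM
    have h' : glue L ((m / L.index : ℕ) : ℤ) q = glue M ((m / M.index : ℕ) : ℤ) r :=
      congrArg Subtype.val h
    have nz : ∀ d ∈ m.divisors, ((m / d : ℕ) : ℤ) ≠ 0 := fun d hd => by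
      have := (Nat.div_pos (Nat.le_of_dvd hm (Nat.dvd_of_mem_divisors hd))
        (Nat.pos_of_mem_divisors hd)).ne'
      exact_mod_cast this
    have hLM : L = M := by
      rw [← glue_comap L _ (nz _ hd) q, h', glue_comap M _ (nz _ he) r]
    subst hLM
    have := glue_inj L _ (nz _ hd) q r h'
    subst this
    rfl
  · rintro ⟨Λ, rfl⟩
    have hi := index_prod_formula Λ
    obtain ⟨k, hk⟩ : ∃ k : ℕ, Λ.map (AddMonoidHom.snd A ℤ) = AddSubgroup.zmultiples (k : ℤ) := by
      obtain ⟨a, ha⟩ := Int.subgroup_cyclic (Λ.map (AddMonoidHom.snd A ℤ))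
      refine ⟨a.natAbs, ?_⟩
      rw [ha, ← AddSubgroup.zmultiples_eq_closure, Int.zmultiples_natAbs]
    have hk0 := hi
    rw [hk, index_zmult] at hk0
    have hpos : 0 < (Λ.comap (AddMonoidHom.inl A ℤ)).index := by
      rcases Nat.eq_zero_or_pos (Λ.comap (AddMonoidHom.inl A ℤ)).index with h | h
      · rw [h] at hk0; omega
      · exact h
    have hdiv : Λ.index / (Λ.comap (AddMonoidHom.inl A ℤ)).index = k := by
      rw [hk0, Nat.mul_div_cancel_left _ hpos]
    obtain ⟨q, hq⟩ := glue_surj Λ k hk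
    refine ⟨⟨⟨(Λ.comap (AddMonoidHom.inl A ℤ)).index, ?_⟩, ⟨_, rfl⟩, q⟩, ?_⟩
    · rw [Nat.mem_divisors]
      exact ⟨⟨_, hk0⟩, by omega⟩
    · apply Subtype.ext
      simp only [glueMap]
      rw [hdiv, hq]

/-- Splitting off the last coordinate, additively. -/
def splitEquiv (n : ℕ) : (Fin (n + 1) → ℤ) ≃+ (Fin n → ℤ) × ℤ where
  toFun f := (fun i => f i.succ, f 0)
  invFun p := Fin.cons p.2 p.1
  left_inv f := by
    ext i
    refine Fin.cases ?_ (fun j => ?_) i <;> simp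
  right_inv p := by ext <;> simp
  map_add' f g := rfl

/-- Transfer of sublattices of given index along an additive equivalence. -/
def indexEquiv {G H : Type*} [AddCommGroup G] [AddCommGroup H] (e : G ≃+ H) (m : ℕ) :
    {Λ : AddSubgroup G // Λ.index = m} ≃ {Λ : AddSubgroup H // Λ.index = m} :=
  Equiv.subtypeEquiv e.mapAddSubgroup.toEquiv (fun Λ => by
    have : (Λ.map (e : G →+ H)).index = Λ.index := AddSubgroup.index_map_equiv Λ e
    rw [← this]; rfl)

theorem main_aux (n : ℕ) : ∀ m : ℕ, 1 ≤ m →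
    Finite {Λ : AddSubgroup (Fin n → ℤ) // Λ.index = m} ∧
    (fixOp^[n] delta1) m = (Nat.card {Λ : AddSubgroup (Fin n → ℤ) // Λ.index = m} : ℂ) := by
  induction n with
  | zero =>
    intro m hm
    haveI : Finite (AddSubgroup (Fin 0 → ℤ)) := inferInstance
    refine ⟨inferInstance, ?_⟩
    have hidx : ∀ Λ : AddSubgroup (Fin 0 → ℤ), Λ.index = 1 := fun Λ => by
      rw [AddSubgroup.index_eq_one]; exact Subsingleton.elim _ _
    simp only [Function.iterate_zero, id, delta1]
    split_ifs with h
    · subst h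
      haveI : Unique {Λ : AddSubgroup (Fin 0 → ℤ) // Λ.index = 1} :=
        ⟨⟨⟨⊤, hidx _⟩⟩, fun a => Subtype.ext (Subsingleton.elim _ _)⟩
      simp
    · haveI : IsEmpty {Λ : AddSubgroup (Fin 0 → ℤ) // Λ.index = m} :=
        ⟨fun a => h (a.2.symm.trans (hidx _))⟩
      simp
  | succ n ih =>
    intro m hm
    have E := (Equiv.ofBijective _ (glueMap_bij (A := Fin n → ℤ) m hm)).trans
      (indexEquiv (splitEquiv n) m).symm
    have hfin : ∀ d : m.divisors, Finite {L : AddSubgroup (Fin n → ℤ) // L.index = d.1} :=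
      fun d => (ih d.1 (Nat.pos_of_mem_divisors d.2)).1
    have hq : ∀ (d : m.divisors) (L : {L : AddSubgroup (Fin n → ℤ) // L.index = d.1}),
        Finite ((Fin n → ℤ) ⧸ L.1) := fun d L => by
      have : L.1.FiniteIndex := ⟨by rw [L.2]; exact (Nat.pos_of_mem_divisors d.2).ne'⟩
      infer_instance
    refine ⟨Finite.of_equiv _ E, ?_⟩
    rw [← Nat.card_congr E, Nat.card_sigma, Function.iterate_succ_apply', fixOp,
      ← Finset.sum_coe_sort]
    push_cast
    refine Finset.sum_congr rfl fun d _ => ?_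
    haveI := Fintype.ofFinite {L : AddSubgroup (Fin n → ℤ) // L.index = d.1}
    rw [Nat.card_sigma, (ih d.1 (Nat.pos_of_mem_divisors d.2)).2,
      Finset.sum_congr rfl (fun (L : {L : AddSubgroup (Fin n → ℤ) // L.index = d.1}) _ =>
        (show Nat.card ((Fin n → ℤ) ⧸ L.1) = d.1 from L.2))]
    simp [mul_comm]

theorem stmt17 (n m : ℕ) (hn : 1 ≤ n) (hm : 1 ≤ m) :
    (fixOp^[n] delta1) m =
      (Nat.card {Λ : AddSubgroup (Fin n → ℤ) // Λ.index = m} : ℂ) :=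
  (main_aux n m hm).2
end

section
/- Let f : ℕ≥1 → ℂ be an arithmetic function, let δ₁(1) = 1 and δ₁(k) = 0 for k > 1, and let y^{(n)} = fix^n(δ₁). Then for all n ≥ 1 and all M ≥ 1, (fix^n(f))(M) = Σ_{k∣M} f(k)·k^n·y^{(n)}(M/k); equivalently, fix^n(f) equals the Dirichlet convolution (f·N^n) ∗ y^{(n)}, where N^n denotes the arithmetic function m ↦ m^n and · the pointwise product. -/
open Complex Finset

theorem swap_aux (G : ℕ → ℕ → ℂ) (M : ℕ) (hM : 1 ≤ M) :
    ∑ d ∈ M.divisors, ∑ k ∈ d.divisors, G k (d / k) =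
      ∑ k ∈ M.divisors, ∑ e ∈ (M / k).divisors, G k e := by
  rw [Finset.sum_sigma', Finset.sum_sigma']
  refine Finset.sum_nbij' (fun x => ⟨x.2, x.1 / x.2⟩) (fun x => ⟨x.1 * x.2, x.1⟩) ?_ ?_ ?_ ?_ ?_
  · rintro ⟨d, k⟩ h
    simp only [Finset.mem_sigma, Nat.mem_divisors] at h ⊢
    obtain ⟨⟨hd, h0⟩, hk, hd0⟩ := h
    have hkM := hk.trans hd
    refine ⟨⟨hkM, h0⟩, Nat.div_dvd_div hk hd, ?_⟩
    exact (Nat.div_pos (Nat.le_of_dvd hM hkM) (Nat.pos_of_dvd_of_pos hkM hM)).ne'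
  · rintro ⟨k, e⟩ h
    simp only [Finset.mem_sigma, Nat.mem_divisors] at h ⊢
    obtain ⟨⟨hk, h0⟩, he, hd0⟩ := h
    have h1 : k * e ∣ M := by
      have := Nat.mul_dvd_mul_left k he
      rwa [Nat.mul_div_cancel' hk] at this
    exact ⟨⟨h1, h0⟩, Dvd.intro _ rfl, (Nat.pos_of_dvd_of_pos h1 hM).ne'⟩
  · rintro ⟨d, k⟩ h
    simp only [Finset.mem_sigma, Nat.mem_divisors] at h
    simp [Nat.mul_div_cancel' h.2.1]
  · rintro ⟨k, e⟩ h
    simp only [Finset.mem_sigma, Nat.mem_divisors] at h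
    simp [Nat.mul_div_cancel_left e (Nat.pos_of_dvd_of_pos h.1.1 hM)]
  · rintro ⟨d, k⟩ h
    rfl

theorem stmt18 (f : ℕ → ℂ) :
    ∀ n : ℕ, 1 ≤ n → ∀ M : ℕ, 1 ≤ M →
      (fixOp^[n] f) M =
        ∑ k ∈ M.divisors, f k * (k : ℂ) ^ n * (fixOp^[n] delta1) (M / k) := by
  intro n hn
  clear hn
  induction n with
  | zero =>
    intro M hM
    rw [Finset.sum_eq_single M]
    · simp [delta1, Nat.div_self hM]
    · intro b hb hne
      have : M / b ≠ 1 := by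
        intro h
        have h2 := Nat.mul_div_cancel' (Nat.dvd_of_mem_divisors hb)
        rw [h] at h2
        omega
      simp [delta1, this]
    · intro h
      exact absurd (Nat.mem_divisors_self M (by omega)) h
  | succ n ih =>
    intro M hM
    replace ih : ∀ M : ℕ, 1 ≤ M → (fixOp^[n] f) M =
        ∑ k ∈ M.divisors, f k * (k : ℂ) ^ n * (fixOp^[n] delta1) (M / k) := by
      first
      | exact ih
      | exact ih (by omega)
    rw [Function.iterate_succ_apply', Function.iterate_succ_apply']
    have key := swap_aux
      (fun k e => f k * (k : ℂ) ^ (n + 1) * ((e : ℂ) * (fixOp^[n] delta1) e)) M hM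
    simp only [fixOp, Finset.mul_sum] at key ⊢
    rw [← key]
    refine Finset.sum_congr rfl fun d hd => ?_
    have hdp := Nat.pos_of_mem_divisors hd
    change (d : ℂ) * (fixOp^[n] f) d = _
    rw [ih d hdp, Finset.mul_sum]
    refine Finset.sum_congr rfl fun k hk => ?_
    have h2 : (d : ℂ) = (k : ℂ) * ((d / k : ℕ) : ℂ) := by
      rw [← Nat.cast_mul, Nat.mul_div_cancel' (Nat.dvd_of_mem_divisors hk)]
    change _ = f k * (k : ℂ) ^ (n + 1) * (((d / k : ℕ) : ℂ) * (fixOp^[n] delta1) (d / k))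
    rw [h2]
    ring
end

section
/- Let f : ℕ≥1 → ℝ be a non-negative arithmetic function (f(n) ≥ 0 for all n), and let M ≥ 1 be such that (fix^r(f))(M) ≠ 0 for some r ∈ ℕ. Then the ratio (fix^{n+1}(f))(M) / (fix^{n}(f))(M) converges to M as n → ∞. -/
open Finset

/-- The `fix` operator on real-valued arithmetic functions:
`fix(f)(n) = ∑_{d ∣ n} d · f(d)`. -/
noncomputable def fixR (f : ℕ → ℝ) : ℕ → ℝ := fun n => ∑ d ∈ n.divisors, (d : ℝ) * f d

lemma fixR_iter_nonneg (f : ℕ → ℝ) (hf : ∀ n : ℕ, 1 ≤ n → 0 ≤ f n) (n : ℕ) :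
    ∀ m : ℕ, 1 ≤ m → 0 ≤ (fixR^[n] f) m := by
  induction n with
  | zero => simpa using hf
  | succ n ih =>
    intro m hm
    rw [Function.iterate_succ_apply']
    unfold fixR
    exact Finset.sum_nonneg fun d hd =>
      mul_nonneg (Nat.cast_nonneg d) (ih d (Nat.pos_of_mem_divisors hd))

lemma fixR_split (g : ℕ → ℝ) (M : ℕ) (hM : 1 ≤ M) :
    fixR g M = M * g M + ∑ d ∈ M.properDivisors, (d : ℝ) * g d := by
  unfold fixR
  rw [← Nat.cons_self_properDivisors (by omega), Finset.sum_cons]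

lemma fixR_bound (f : ℕ → ℝ) (hf : ∀ n : ℕ, 1 ≤ n → 0 ≤ f n) (M : ℕ) :
    1 ≤ M → ∃ C : ℝ, 0 ≤ C ∧ ∀ n, (fixR^[n] f) M ≤ C * (M : ℝ) ^ n := by
  induction M using Nat.strong_induction_on with
  | _ M ih =>
  intro hM
  have ih' : ∀ d : ℕ, ∃ C : ℝ, d ∈ M.properDivisors →
      (0 ≤ C ∧ ∀ n, (fixR^[n] f) d ≤ C * (d : ℝ) ^ n) := by
    intro d
    by_cases hd : d ∈ M.properDivisors
    · obtain ⟨C, hC⟩ := ih d (Nat.mem_properDivisors.1 hd).2 (Nat.pos_of_mem_properDivisors hd)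
      exact ⟨C, fun _ => hC⟩
    · exact ⟨0, fun h => absurd h hd⟩
  choose C hC using ih'
  set S := ∑ d ∈ M.properDivisors, C d with hS
  have hS0 : 0 ≤ S := Finset.sum_nonneg fun d hd => (hC d hd).1
  have hsum : ∀ n, ∑ d ∈ M.properDivisors, (d : ℝ) * (fixR^[n] f) d
      ≤ S * ((M : ℝ) / 2) ^ (n + 1) := by
    intro n
    rw [hS, Finset.sum_mul]
    refine Finset.sum_le_sum fun d hd => ?_
    have h2 : (d : ℝ) ≤ (M : ℝ) / 2 := by
      obtain ⟨⟨k, hk⟩, hlt⟩ := Nat.mem_properDivisors.1 hd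
      have hk2 : 2 ≤ k := by
        by_contra hlt2
        have : k = 0 ∨ k = 1 := by omega
        rcases this with rfl | rfl <;> omega
      have : d * 2 ≤ M := by rw [hk]; exact Nat.mul_le_mul_left d hk2
      have : (d : ℝ) * 2 ≤ M := by exact_mod_cast this
      linarith
    calc (d : ℝ) * (fixR^[n] f) d ≤ d * (C d * (d : ℝ) ^ n) :=
          mul_le_mul_of_nonneg_left ((hC d hd).2 n) (Nat.cast_nonneg d)
      _ = C d * (d : ℝ) ^ (n + 1) := by ring
      _ ≤ _ := mul_le_mul_of_nonneg_left (pow_le_pow_left₀ (Nat.cast_nonneg d) h2 _) (hC d hd).1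
  have key : ∀ n, (fixR^[n] f) M ≤ (f M + S) * (M : ℝ) ^ n - S * ((M : ℝ) / 2) ^ n := by
    intro n
    induction n with
    | zero => simp
    | succ n ihn =>
      rw [Function.iterate_succ_apply', fixR_split _ M hM]
      have h1 := hsum n
      have h2 := mul_le_mul_of_nonneg_left ihn (Nat.cast_nonneg (α := ℝ) M)
      have e : (M : ℝ) * ((f M + S) * (M : ℝ) ^ n - S * ((M : ℝ) / 2) ^ n)
        = (f M + S) * (M : ℝ) ^ (n + 1) - 2 * (S * ((M : ℝ) / 2) ^ (n + 1)) := by ring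
      linarith
  refine ⟨f M + S, add_nonneg (hf M hM) hS0, fun n => (key n).trans ?_⟩
  have : 0 ≤ S * ((M : ℝ) / 2) ^ n := by positivity
  linarith

theorem stmt19 (f : ℕ → ℝ) (hf : ∀ n : ℕ, 1 ≤ n → 0 ≤ f n)
    (M : ℕ) (hM : 1 ≤ M) (h : ∃ r : ℕ, (fixR^[r] f) M ≠ 0) :
    Filter.Tendsto (fun n : ℕ => (fixR^[n + 1] f) M / (fixR^[n] f) M)
      Filter.atTop (nhds (M : ℝ)) := by
  obtain ⟨r, hr⟩ := h
  obtain ⟨C, hC0, hC⟩ := fixR_bound f hf M hM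
  have hMp : (0 : ℝ) < M := by exact_mod_cast hM
  set b : ℕ → ℝ := fun n => (fixR^[n] f) M / (M : ℝ) ^ n with hb
  have hmono : Monotone b := by
    refine monotone_nat_of_le_succ fun n => ?_
    simp only [hb]
    rw [Function.iterate_succ_apply', fixR_split _ M hM, div_le_div_iff₀ (by positivity)
      (by positivity)]
    have h0 : 0 ≤ ∑ d ∈ M.properDivisors, (d : ℝ) * (fixR^[n] f) d :=
      Finset.sum_nonneg fun d hd => mul_nonneg (Nat.cast_nonneg d)
        (fixR_iter_nonneg f hf n d (Nat.pos_of_mem_properDivisors hd))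
    have h1 := mul_nonneg h0 (pow_pos hMp n).le
    rw [pow_succ]
    linarith
  have hbdd : BddAbove (Set.range b) := by
    refine ⟨C, ?_⟩
    rintro _ ⟨n, rfl⟩
    exact (div_le_iff₀ (by positivity)).2 (hC n)
  have hlim := tendsto_atTop_ciSup hmono hbdd
  have hpos : 0 < b r :=
    div_pos (lt_of_le_of_ne (fixR_iter_nonneg f hf r M hM) hr.symm) (by positivity)
  have hL : (⨆ i, b i) ≠ 0 := (hpos.trans_le (le_ciSup hbdd r)).ne'
  have h1 := (((Filter.tendsto_add_atTop_iff_nat 1).2 hlim).div hlim hL).const_mul (M : ℝ)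
  rw [div_self hL, mul_one] at h1
  refine h1.congr fun n => ?_
  simp only [hb, Pi.div_apply]
  rw [pow_succ]
  by_cases hz : (fixR^[n] f) M = 0
  · simp [hz]
  · field_simp
end
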